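/- arXiv:2411.10767 — 2 statements merged into one kernel-verified Lean document; each statement's English description precedes it below -/
import Mathlib

section
/- Green's formula: Let A be a finitary hereditary abelian category over a finite field k = F_q and let A, B, A', B' be fixed objects of A. Then a_A · a_B · a_{A'} · a_{B'} · ∑_{[C] ∈ Iso(A)} g^C_{AB} · g^C_{A'B'} / a_C = ∑_{[X],[Y],[X'],[Y'] ∈ Iso(A)} (|Ext^1_A(X,Y')| / |Hom_A(X,Y')|) · g^A_{XX'} · g^B_{YY'} · g^{A'}_{XY} · g^{B'}_{X'Y'} · a_X · a_Y · a_{X'} · a_{Y'}, where both sums run over isomorphism classes of objects of A. -/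
/-!
STATEMENT 0 (Green's formula).
`A` is a small abelian category, linear over a finite field `k`, which is finitary
(finite Hom-sets and finite Ext¹-groups) and hereditary (Ext² vanishes).
For fixed objects `a b a' b'` of `A`, Green's formula holds, where both sums run over
the isomorphism classes of objects of `A` (encoded by the quotient `IsoCl A`), and
where `hall a b c` is the Hall number `g^c_{a b}` and `autCard X = |Aut X|`.
-/

open CategoryTheory CategoryTheory.Limits

noncomputable section

namespace GreenDH

/-- The type of isomorphism classes of objects of a category. -/
def IsoCl (C : Type*) [Category C] : Type _ := Quotient (CategoryTheory.isIsomorphicSetoid C)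

/-- The isomorphism class of an object. -/
def cl {C : Type*} [Category C] (X : C) : IsoCl C := Quotient.mk _ X

/-- A representative of an isomorphism class. -/
def IsoCl.out {C : Type*} [Category C] (s : IsoCl C) : C := Quotient.out s

/-- `a_X`, the order of the automorphism group of `X`. -/
def autCard {C : Type*} [Category C] (X : C) : ℕ := Nat.card (Aut X)

/-- `|Hom(X, Y)|`. -/
def homCard {C : Type*} [Category C] (X Y : C) : ℕ := Nat.card (X ⟶ Y)

/-- `|Ext¹(X, Y)|`. -/
def ext1Card {A : Type} [SmallCategory A] [Abelian A] [HasExt.{0} A] (X Y : A) : ℕ :=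
  Nat.card (Abelian.Ext X Y 1)

/-- The Hall number `g^c_{a b}`: the number of subobjects of `c` which are isomorphic to `b`
and whose corresponding quotient of `c` is isomorphic to `a`. -/
def hall {A : Type} [SmallCategory A] [Abelian A] (a b c : A) : ℕ :=
  Nat.card {S : Subobject c // Nonempty ((S : A) ≅ b) ∧ Nonempty ((cokernel S.arrow) ≅ a)}

open DerivedCategory in
theorem efface_derived {C : Type} [SmallCategory C] [Abelian C] [HasDerivedCategory.{0} C]
    (X : C) (Z : DerivedCategory C) [Z.IsLE (-1)] (f : (singleFunctor C 0).obj X ⟶ Z) :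
    ∃ (E : C) (π : E ⟶ X), Epi π ∧ (singleFunctor C 0).map π ≫ f = 0 := by
  obtain ⟨W, hW, ⟨e⟩⟩ := Z.exists_iso_Q_obj_of_isLE (-1)
  let f' : Q.obj ((CochainComplex.singleFunctor C 0).obj X) ⟶ Q.obj W := f ≫ e.hom
  obtain ⟨X', hX', s, hs, g, hf'⟩ := right_fac_of_isStrictlyLE f' 0
  have hs' : QuasiIso s := by rwa [isIso_Q_map_iff_quasiIso] at hs
  let s0 : X' ⟶ (HomologicalComplex.single C (ComplexShape.up ℤ) 0).obj X := s
  let ι : (HomologicalComplex.single C (ComplexShape.up ℤ) 0).obj (X'.X 0) ⟶ X' :=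
    HomologicalComplex.mkHomFromSingle (𝟙 (X'.X 0)) (fun k hk => by
      apply (X'.isZero_of_isStrictlyLE 0 k (by simp at hk; omega)).eq_of_tgt)
  let π : X'.X 0 ⟶ X := s0.f 0 ≫ (HomologicalComplex.singleObjXSelf (ComplexShape.up ℤ) 0 X).hom
  have hι : ι ≫ s0 = (HomologicalComplex.single C (ComplexShape.up ℤ) 0).map π := by
    apply HomologicalComplex.from_single_hom_ext
    rw [HomologicalComplex.comp_f, HomologicalComplex.mkHomFromSingle_f,
      HomologicalComplex.single_map_f_self]
    simp [π]
  have h0 : ι ≫ g = 0 := by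
    apply HomologicalComplex.from_single_hom_ext
    apply (W.isZero_of_isStrictlyLE (-1) 0 (by norm_num)).eq_of_tgt
  refine ⟨X'.X 0, π, ?_, ?_⟩
  · have : Epi (s0.f 0) := by
      rw [epi_iff_surjective_up_to_refinements]
      intro A y
      have h1 : QuasiIsoAt s 0 := inferInstance
      have h2 : Epi (HomologicalComplex.homologyMap s 0) := by
        have := (quasiIsoAt_iff_isIso_homologyMap s 0).1 h1
        infer_instance
      have h3 := (ShortComplex.epi_homologyMap_iff_up_to_refinements _).1 h2 y
        (((HomologicalComplex.isZero_single_obj_X (ComplexShape.up ℤ) 0 X _ (by simp)).eq_of_tgt _ _))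
      obtain ⟨A', p, hp, x, _, y₁, h⟩ := h3
      have h9 : y₁ = 0 := ((HomologicalComplex.isZero_single_obj_X (ComplexShape.up ℤ) 0 X _
        (by simp)).eq_of_tgt _ _)
      rw [h9, zero_comp, add_zero] at h
      exact ⟨A', p, hp, x, h⟩
    exact epi_comp _ _
  · have h5 : Q.map ((HomologicalComplex.single C (ComplexShape.up ℤ) 0).map π) ≫ f' = 0 := by
      rw [hf', ← hι, Functor.map_comp]
      change (Q.map ι ≫ Q.map s) ≫ inv (Q.map s) ≫ Q.map g = 0
      rw [Category.assoc, IsIso.hom_inv_id_assoc, ← Functor.map_comp, h0, Functor.map_zero]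
    rw [← cancel_mono e.hom, zero_comp, Category.assoc]
    exact h5

open DerivedCategory Abelian in
theorem efface {C : Type} [SmallCategory C] [Abelian C] [HasExt.{0} C]
    (X Y : C) (ξ : Ext X Y 1) :
    ∃ (E : C) (π : E ⟶ X), Epi π ∧ (Ext.mk₀ π).comp ξ (zero_add 1) = 0 := by
  let := HasDerivedCategory.standard C
  have : (((singleFunctor C 0).obj Y)⟦((1:ℕ):ℤ)⟧).IsLE (-1) := by
    have := TStructure.t.isLE_shift ((singleFunctor C 0).obj Y) 0 1 (-1) (by norm_num)
    exact this
  obtain ⟨E, π, h, h'⟩ := efface_derived X _ ξ.hom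
  refine ⟨E, π, h, ?_⟩
  ext
  simp only [Ext.comp_hom, Ext.mk₀_hom, Ext.zero_hom, ShiftedHom.mk₀_comp]
  exact h'

section SES
open Abelian
variable {C : Type} [SmallCategory C] [Abelian C]

/-- `0 → b → c → a → 0` is short exact. -/
def SES {b c a : C} (f : b ⟶ c) (g : c ⟶ a) : Prop :=
  ∃ w : f ≫ g = 0, (ShortComplex.mk f g w).ShortExact

namespace SES
variable {b c a : C} {f : b ⟶ c} {g : c ⟶ a}

theorem w (h : SES f g) : f ≫ g = 0 := h.choose
theorem mono (h : SES f g) : Mono f := h.choose_spec.mono_f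
theorem epi (h : SES f g) : Epi g := h.choose_spec.epi_g
theorem lift (h : SES f g) {T : C} (t : T ⟶ c) (ht : t ≫ g = 0) : ∃ s : T ⟶ b, s ≫ f = t := by
  have := h.mono
  have h2 := h.choose_spec
  have := h2.mono_f
  exact ⟨h2.exact.lift t ht, h2.exact.lift_f t ht⟩
theorem desc (h : SES f g) {T : C} (t : c ⟶ T) (ht : f ≫ t = 0) : ∃ s : a ⟶ T, g ≫ s = t := by
  have h2 := h.choose_spec
  have := h2.epi_g
  exact ⟨h2.exact.desc t ht, h2.exact.g_desc t ht⟩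

theorem mk' (hf : Mono f) (hg : Epi g) (w : f ≫ g = 0)
    (h : ∀ (T : C) (t : T ⟶ c), t ≫ g = 0 →
      ∃ (T' : C) (π : T' ⟶ T) (_ : Epi π) (s : T' ⟶ b), π ≫ t = s ≫ f) : SES f g :=
  ⟨w, { exact := (ShortComplex.exact_iff_exact_up_to_refinements _).2 (fun T t ht => h T t ht),
        mono_f := hf, epi_g := hg }⟩

theorem of_epi (hg : Epi g) : SES (kernel.ι g) g :=
  ⟨kernel.condition g, { exact := ShortComplex.exact_kernel g, epi_g := hg }⟩

theorem of_mono (hf : Mono f) : SES f (cokernel.π f) :=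
  ⟨cokernel.condition f, { exact := ShortComplex.exact_cokernel f, mono_f := hf }⟩

theorem of_iso (h : SES f g) {b' a' c' : C} (β : b' ≅ b) (γ : c ≅ c') (α : a ≅ a') :
    SES (β.hom ≫ f ≫ γ.hom) (γ.inv ≫ g ≫ α.hom) := by
  have := h.mono
  have := h.epi
  refine mk' inferInstance inferInstance ?_ ?_
  · simp [reassoc_of% h.w]
  · intro T t ht
    obtain ⟨s, hs⟩ := h.lift (t ≫ γ.inv) (by
      rw [← cancel_mono α.hom]; simpa using ht)
    refine ⟨T, 𝟙 T, inferInstance, s ≫ β.inv, ?_⟩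
    simp [reassoc_of% hs]

variable [HasExt.{0} C]

/-- the extension class -/
def cls (h : SES f g) : Ext a b 1 := h.choose_spec.extClass

theorem pullback_cls (h : SES f g) : (Ext.mk₀ g).comp h.cls (zero_add 1) = 0 :=
  h.choose_spec.comp_extClass

theorem natural {b₁ c₁ a₁ : C} {f₁ : b₁ ⟶ c₁} {g₁ : c₁ ⟶ a₁} (h₁ : SES f₁ g₁)
    (h : SES f g) (φ : b₁ ⟶ b) (m : c₁ ⟶ c) (ψ : a₁ ⟶ a) (h1 : f₁ ≫ m = φ ≫ f)
    (h2 : m ≫ g = g₁ ≫ ψ) :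
    h₁.cls.comp (Ext.mk₀ φ) (add_zero 1) = (Ext.mk₀ ψ).comp h.cls (zero_add 1) :=
  ShortComplex.ShortExact.extClass_naturality h₁.choose_spec h.choose_spec
    (ShortComplex.homMk φ m ψ h1.symm h2)

theorem cov₃ (h : SES f g) {T : C} (t : T ⟶ a) (ht : (Ext.mk₀ t).comp h.cls (zero_add 1) = 0) :
    ∃ s : T ⟶ c, s ≫ g = t := by
  obtain ⟨x, hx⟩ := Ext.covariant_sequence_exact₃ T h.choose_spec (Ext.mk₀ t) (zero_add 1) ht
  obtain ⟨s, rfl⟩ := (Ext.mk₀_bijective _ _).2 x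
  refine ⟨s, (Ext.mk₀_bijective _ _).1 ?_⟩
  rw [← hx, Ext.mk₀_comp_mk₀]

theorem con₁ (h : SES f g) {T : C} (t : b ⟶ T) (ht : h.cls.comp (Ext.mk₀ t) (add_zero 1) = 0) :
    ∃ s : c ⟶ T, f ≫ s = t := by
  obtain ⟨x, hx⟩ := Ext.contravariant_sequence_exact₁ h.choose_spec T (Ext.mk₀ t) (add_zero 1) ht
  obtain ⟨s, rfl⟩ := (Ext.mk₀_bijective _ _).2 x
  refine ⟨s, (Ext.mk₀_bijective _ _).1 ?_⟩
  rw [← hx, Ext.mk₀_comp_mk₀]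

theorem con₃ (h : SES f g) {T : C} (ξ : Ext a T 1)
    (ht : (Ext.mk₀ g).comp ξ (zero_add 1) = 0) :
    ∃ s : b ⟶ T, h.cls.comp (Ext.mk₀ s) (add_zero 1) = ξ := by
  obtain ⟨x, hx⟩ := Ext.contravariant_sequence_exact₃ h.choose_spec T ξ ht (add_zero 1)
  obtain ⟨s, rfl⟩ := (Ext.mk₀_bijective _ _).2 x
  exact ⟨s, hx⟩

theorem con₂ (h : SES f g) {T : C} (ξ : Ext c T 1)
    (ht : (Ext.mk₀ f).comp ξ (zero_add 1) = 0) :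
    ∃ s : Ext a T 1, (Ext.mk₀ g).comp s (zero_add 1) = ξ :=
  Ext.contravariant_sequence_exact₂ h.choose_spec T ξ ht

theorem con₁' (h : SES f g) {T : C} (ξ : Ext b T 1) (h2 : Subsingleton (Ext a T 2)) :
    ∃ s : Ext c T 1, (Ext.mk₀ f).comp s (zero_add 1) = ξ :=
  Ext.contravariant_sequence_exact₁ h.choose_spec T ξ (n₁ := 2) rfl (Subsingleton.elim _ _)

theorem cls_comp_f (h : SES f g) {T : C} (s : c ⟶ T) :
    h.cls.comp (Ext.mk₀ (f ≫ s)) (add_zero 1) = 0 := by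
  have := h.choose_spec.extClass_comp_assoc (Ext.mk₀ s) (h := add_zero 1)
  rwa [Ext.mk₀_comp_mk₀] at this

/-- Lifting a morphism of quotients to a morphism of extensions. -/
theorem exists_map {K P I c Q : C} {κ : K ⟶ P} {π : P ⟶ I} (h : SES κ π) {j : K ⟶ c} {e : c ⟶ Q}
    (h' : SES j e) (ι : I ⟶ Q) (hc : (Ext.mk₀ ι).comp h'.cls (zero_add 1) = h.cls) :
    ∃ m : P ⟶ c, κ ≫ m = j ∧ m ≫ e = π ≫ ι := by
  obtain ⟨m, hm⟩ := h'.cov₃ (π ≫ ι) (by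
    rw [← Ext.mk₀_comp_mk₀_assoc, hc, h.pullback_cls])
  obtain ⟨g, hg⟩ := h'.lift (κ ≫ m) (by rw [Category.assoc, hm, reassoc_of% h.w, zero_comp])
  have h1 := h.natural h' g m ι hg.symm hm
  obtain ⟨s, hs⟩ := h.con₁ (g - 𝟙 K) (by
    rw [sub_eq_add_neg, Ext.mk₀_add, Ext.comp_add, h1, hc, Ext.mk₀_neg, Ext.comp_neg,
      Ext.comp_mk₀_id, add_neg_cancel])
  refine ⟨m - s ≫ j, ?_, ?_⟩
  · rw [Preadditive.comp_sub, reassoc_of% hs, ← hg]; simp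
  · rw [Preadditive.sub_comp, hm, Category.assoc, h'.w]; simp

theorem isIso_of {K Q c c' : C} {j : K ⟶ c} {e : c ⟶ Q} {j' : K ⟶ c'} {e' : c' ⟶ Q}
    (h : SES j e) (h' : SES j' e') (m : c ⟶ c') (h1 : j ≫ m = j') (h2 : m ≫ e' = e) : IsIso m := by
  let φ : ShortComplex.mk j e h.w ⟶ ShortComplex.mk j' e' h'.w :=
    ShortComplex.homMk (𝟙 _) m (𝟙 _) (by simp [h1]) (by simp [h2])
  have : IsIso φ.τ₁ := inferInstanceAs (IsIso (𝟙 K))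
  have : IsIso φ.τ₃ := inferInstanceAs (IsIso (𝟙 Q))
  exact ShortComplex.isIso₂_of_shortExact_of_isIso₁₃ φ h.choose_spec h'.choose_spec

theorem exists_iso {K Q c c' : C} {j : K ⟶ c} {e : c ⟶ Q} {j' : K ⟶ c'} {e' : c' ⟶ Q}
    (h : SES j e) (h' : SES j' e') (hc : h.cls = h'.cls) :
    ∃ m : c ≅ c', j ≫ m.hom = j' ∧ m.hom ≫ e' = e := by
  obtain ⟨m, h1, h2⟩ := h.exists_map h' (𝟙 Q) (by rw [Ext.mk₀_id_comp, hc])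
  rw [Category.comp_id] at h2
  have := h.isIso_of h' m h1 h2
  exact ⟨asIso m, h1, h2⟩

theorem _root_.GreenDH.pushout_cover {X Y Z : C} (f : X ⟶ Y) (g : X ⟶ Z) {T : C}
    (t : T ⟶ pushout f g) :
    ∃ (T' : C) (p : T' ⟶ T) (_ : Epi p) (y : T' ⟶ Y) (z : T' ⟶ Z),
      p ≫ t = y ≫ pushout.inl f g + z ≫ pushout.inr f g := by
  have : Epi (biprod.desc (pushout.inl f g) (pushout.inr f g)) := by
    constructor
    intro Z u v huv
    apply pushout.hom_ext
    · have := biprod.inl ≫= huv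
      rwa [biprod.inl_desc_assoc, biprod.inl_desc_assoc] at this
    · have := biprod.inr ≫= huv
      rwa [biprod.inr_desc_assoc, biprod.inr_desc_assoc] at this
  obtain ⟨T', p, hp, x, hx⟩ := surjective_up_to_refinements_of_epi
    (biprod.desc (pushout.inl f g) (pushout.inr f g)) t
  refine ⟨T', p, hp, x ≫ biprod.fst, x ≫ biprod.snd, ?_⟩
  rw [hx, biprod.desc_eq, Preadditive.comp_add, Category.assoc, Category.assoc]

theorem realize {K Q : C} (ξ : Ext Q K 1) :
    ∃ (c : C) (j : K ⟶ c) (e : c ⟶ Q) (h : SES j e), h.cls = ξ := by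
  obtain ⟨E, π, hπ, h0⟩ := efface Q K ξ
  have h := of_epi hπ
  obtain ⟨s, hs⟩ := h.con₃ ξ h0
  obtain ⟨e, he1, he2⟩ : ∃ e : pushout (kernel.ι π) s ⟶ Q, pushout.inl _ _ ≫ e = π ∧
      pushout.inr _ _ ≫ e = 0 := ⟨pushout.desc π 0 (by simp), pushout.inl_desc _ _ _,
        pushout.inr_desc _ _ _⟩
  have h' : SES (pushout.inr (kernel.ι π) s) e := by
    refine mk' inferInstance ?_ he2 ?_
    · have : Epi (pushout.inl (kernel.ι π) s ≫ e) := by rwa [he1]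
      exact epi_of_epi (pushout.inl (kernel.ι π) s) e
    · intro T t ht
      obtain ⟨T', p, hp, x, y, hx⟩ := pushout_cover _ _ t
      have h3 : x ≫ π = 0 := by
        have h5 := hx =≫ e
        simpa [ht, he1, he2] using h5.symm
      obtain ⟨z, hz⟩ := h.lift _ h3
      refine ⟨T', p, hp, z ≫ s + y, ?_⟩
      rw [hx, ← hz, Preadditive.add_comp, Category.assoc, Category.assoc, pushout.condition]
  refine ⟨_, _, _, h', ?_⟩
  have := h.natural h' s (pushout.inl _ _) (𝟙 Q) pushout.condition (by simp [he1])
  rw [← hs, this, Ext.mk₀_id_comp]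

end SES
end SES

section count
open Abelian
variable {C : Type} [SmallCategory C]

theorem cl_eq_iff (X Y : C) : cl X = cl Y ↔ Nonempty (X ≅ Y) :=
  Quotient.eq (r := isIsomorphicSetoid C)

theorem cl_out (x : IsoCl C) : cl x.out = x := Quotient.out_eq x

theorem finite_iso (hfin : ∀ X Y : C, Finite (X ⟶ Y)) (X Y : C) : Finite (X ≅ Y) :=
  Finite.of_injective (fun e : X ≅ Y => e.hom) (fun _ _ h => Iso.ext h)

theorem autCard_pos (hfin : ∀ X Y : C, Finite (X ⟶ Y)) (X : C) : 0 < autCard X := by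
  have : Finite (Aut X) := finite_iso hfin X X
  exact Nat.card_pos

theorem card_iso_of_iso {X Y Y' : C} (e : Y ≅ Y') : Nat.card (X ≅ Y) = Nat.card (X ≅ Y') :=
  Nat.card_congr ⟨fun f => f ≪≫ e, fun f => f ≪≫ e.symm, fun f => by ext; simp, fun f => by ext; simp⟩

theorem card_iso_self {X Y : C} (e : X ≅ Y) : Nat.card (X ≅ Y) = autCard X :=
  (card_iso_of_iso e).symm

theorem card_iso_self' {X Y : C} (e : X ≅ Y) : Nat.card (X ≅ Y) = autCard Y := by
  change Nat.card (X ≅ Y) = Nat.card (Y ≅ Y)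
  exact Nat.card_congr ⟨fun f => e.symm ≪≫ f, fun f => e ≪≫ f, fun f => by ext; simp,
    fun f => by ext; simp⟩

open Classical in
theorem iso_card (X Y : C) : Nat.card (X ≅ Y) = if cl X = cl Y then autCard X else 0 := by
  split_ifs with h
  · rw [cl_eq_iff] at h
    exact card_iso_self h.some
  · rw [cl_eq_iff, not_nonempty_iff] at h
    simp

theorem isoSum (hfin : ∀ X Y : C, Finite (X ⟶ Y)) (T : Finset (IsoCl C)) (z : C) (hz : cl z ∈ T) :
    ∑ y ∈ T, (Nat.card (y.out ≅ z) : ℚ) / autCard y.out = 1 := by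
  classical
  rw [Finset.sum_eq_single_of_mem (cl z) hz]
  · have h : Nonempty ((cl z).out ≅ z) := by rw [← cl_eq_iff, cl_out]
    rw [card_iso_self h.some, div_self]
    exact_mod_cast (autCard_pos hfin _).ne'
  · intro y _ hy
    rw [iso_card, cl_out, if_neg hy]
    simp

theorem masterSum (hfin : ∀ X Y : C, Finite (X ⟶ Y)) (T : Finset (IsoCl C))
    {R : Type} [Finite R] (κ : R → C) (S : C → Type) (e : ∀ y, S y ≃ Σ r : R, (y ≅ κ r))
    (hT : ∀ r, cl (κ r) ∈ T) :
    ∑ y ∈ T, (Nat.card (S y.out) : ℚ) / autCard y.out = Nat.card R := by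
  have := Fintype.ofFinite R
  have := finite_iso hfin
  simp_rw [fun y => Nat.card_congr (e y), Nat.card_sigma, Nat.cast_sum, Finset.sum_div]
  rw [Finset.sum_comm]
  simp_rw [fun r => isoSum hfin T (κ r) (hT r)]
  simp

theorem card_fib {α β : Type} [Finite α] [Finite β] (f : α → β) (n : ℕ)
    (h : ∀ b, Nat.card {a // f a = b} = n) : Nat.card α = Nat.card β * n := by
  have := Fintype.ofFinite β
  rw [← Nat.card_congr (Equiv.sigmaFiberEquiv f), Nat.card_sigma]
  simp [h]

variable [Abelian C] [HasExt.{0} C]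

theorem extCount (hfin : ∀ X Y : C, Finite (X ⟶ Y)) {K Q c c₀ : C} {j₀ : K ⟶ c₀} {e₀ : c₀ ⟶ Q}
    (h₀ : SES j₀ e₀) :
    Nat.card (c ≅ c₀) =
      Nat.card {p : (K ⟶ c) × (c ⟶ Q) // ∃ h : SES p.1 p.2, h.cls = h₀.cls} * Nat.card (Q ⟶ K) := by
  have := finite_iso hfin c c₀
  let F : (c ≅ c₀) → {p : (K ⟶ c) × (c ⟶ Q) // ∃ h : SES p.1 p.2, h.cls = h₀.cls} := fun φ =>
    ⟨(j₀ ≫ φ.inv, φ.hom ≫ e₀), by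
      have h1 : SES (j₀ ≫ φ.inv) (φ.hom ≫ e₀) := by
        simpa using h₀.of_iso (Iso.refl _) φ.symm (Iso.refl _)
      refine ⟨h1, ?_⟩
      have := h1.natural h₀ (𝟙 K) φ.hom (𝟙 Q) (by simp) (by simp)
      rwa [Ext.comp_mk₀_id, Ext.mk₀_id_comp] at this⟩
  apply card_fib F
  rintro ⟨⟨j, e⟩, h, hc⟩
  dsimp only at h hc
  obtain ⟨φ, h1, h2⟩ := h.exists_iso h₀ hc
  symm
  apply Nat.card_congr
  have hj : Mono j₀ := h₀.mono
  have he : Epi e := h.epi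
  have key : ∀ k : Q ⟶ K, j ≫ (φ.hom + e ≫ k ≫ j₀) = j₀ ∧ (φ.hom + e ≫ k ≫ j₀) ≫ e₀ = e := by
    intro k
    constructor
    · rw [Preadditive.comp_add, h1, reassoc_of% h.w]; simp
    · rw [Preadditive.add_comp, h2]; simp [h₀.w]
  refine Equiv.ofBijective (fun k : Q ⟶ K => ?_) ?_
  · have := h.isIso_of h₀ (φ.hom + e ≫ k ≫ j₀) (key k).1 (key k).2
    refine ⟨asIso (φ.hom + e ≫ k ≫ j₀), ?_⟩
    apply Subtype.ext
    apply Prod.ext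
    · change j₀ ≫ inv (φ.hom + e ≫ k ≫ j₀) = j
      rw [IsIso.comp_inv_eq, (key k).1]
    · exact (key k).2
  · constructor
    · intro k k' hk
      have h3 := congrArg (fun x => x.1.hom) hk
      simp only [asIso_hom] at h3
      have h4 := add_left_cancel h3
      rwa [cancel_epi, cancel_mono] at h4
    · rintro ⟨ψ, hψ⟩
      have h3 : j₀ ≫ ψ.inv = j := congrArg (fun x => x.1.1) hψ
      have h4 : ψ.hom ≫ e₀ = e := congrArg (fun x => x.1.2) hψ
      rw [Iso.comp_inv_eq] at h3
      obtain ⟨s, hs⟩ := h₀.lift (ψ.hom - φ.hom) (by rw [Preadditive.sub_comp, h4, h2, sub_self])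
      obtain ⟨k, hk⟩ := h.desc s (by
        rw [← cancel_mono j₀, Category.assoc, hs, Preadditive.comp_sub, ← h3, h1]; simp)
      refine ⟨k, ?_⟩
      apply Subtype.ext
      apply Iso.ext
      simp only [asIso_hom]
      rw [reassoc_of% hk, hs]; simp

theorem mCount {K P I c Q : C} {κ : K ⟶ P} {π : P ⟶ I} (h : SES κ π) {j : K ⟶ c} {e : c ⟶ Q}
    (h' : SES j e) (ι : I ⟶ Q) (hc : (Ext.mk₀ ι).comp h'.cls (zero_add 1) = h.cls) :
    Nat.card {m : P ⟶ c // κ ≫ m = j ∧ m ≫ e = π ≫ ι} = Nat.card (I ⟶ K) := by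
  obtain ⟨m, h1, h2⟩ := h.exists_map h' ι hc
  symm
  apply Nat.card_congr
  have hj : Mono j := h'.mono
  have he : Epi π := h.epi
  refine Equiv.ofBijective (fun k : I ⟶ K => ⟨m + π ≫ k ≫ j, ?_, ?_⟩) ⟨?_, ?_⟩
  · rw [Preadditive.comp_add, h1, reassoc_of% h.w]; simp
  · rw [Preadditive.add_comp, h2]; simp [h'.w]
  · intro k k' hk
    have h3 := congrArg (fun x => x.1) hk
    have h4 := add_left_cancel h3
    rwa [cancel_epi, cancel_mono] at h4
  · rintro ⟨n, h3, h4⟩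
    obtain ⟨s, hs⟩ := h'.lift (n - m) (by rw [Preadditive.sub_comp, h4, h2, sub_self])
    obtain ⟨k, hk⟩ := h.desc s (by
      rw [← cancel_mono j, Category.assoc, hs, Preadditive.comp_sub, h3, h1]; simp)
    refine ⟨k, ?_⟩
    apply Subtype.ext
    dsimp only
    rw [reassoc_of% hk, hs]; simp

theorem card_ker_range {G H : Type} [AddCommGroup G] [AddCommGroup H] (f : G →+ H) :
    Nat.card G = Nat.card f.ker * Nat.card f.range := by
  rw [← AddSubgroup.card_mul_index f.ker, AddSubgroup.index_ker]

theorem kerCount (hfinHom : ∀ X Y : C, Finite (X ⟶ Y))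
    {I Q X K : C} {ι : I ⟶ Q} {ρ : Q ⟶ X} (h : SES ι ρ)
    (h2 : Subsingleton (Ext X K 2)) (η : Ext I K 1) :
    Nat.card {ξ : Ext Q K 1 // (Ext.mk₀ ι).comp ξ (zero_add 1) = η} * Nat.card (I ⟶ K) *
      Nat.card (X ⟶ K) = Nat.card (Ext X K 1) * Nat.card (Q ⟶ K) := by
  let f : (Q ⟶ K) →+ (I ⟶ K) := AddMonoidHom.mk' (fun g => ι ≫ g) (fun g g' => by simp)
  let δ : (I ⟶ K) →+ Ext X K 1 := AddMonoidHom.mk'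
    (fun k => h.cls.comp (Ext.mk₀ k) (add_zero 1)) (fun g g' => by simp [Ext.mk₀_add])
  let g : Ext X K 1 →+ Ext Q K 1 := AddMonoidHom.mk'
    (fun ξ => (Ext.mk₀ ρ).comp ξ (zero_add 1)) (fun g g' => by simp)
  have e1 := card_ker_range f
  have e2 := card_ker_range δ
  have e3 := card_ker_range g
  have r1 : δ.ker = f.range := by
    ext k
    constructor
    · intro hk
      obtain ⟨s, hs⟩ := h.con₁ k hk
      exact ⟨s, hs⟩
    · rintro ⟨s, rfl⟩
      exact h.cls_comp_f s
  have r2 : g.ker = δ.range := by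
    ext k
    constructor
    · intro hk
      obtain ⟨s, hs⟩ := h.con₃ k hk
      exact ⟨s, hs⟩
    · rintro ⟨s, rfl⟩
      change (Ext.mk₀ ρ).comp (h.cls.comp (Ext.mk₀ s) (add_zero 1)) (zero_add 1) = 0
      rw [← Ext.comp_assoc (a₁₂ := 1) _ _ _ (by lia) (by lia) (by lia), h.pullback_cls,
        Ext.zero_comp]
  have r3 : Nat.card f.ker = Nat.card (X ⟶ K) := by
    symm
    have := h.epi
    refine Nat.card_congr (Equiv.ofBijective (fun k => ⟨ρ ≫ k, ?_⟩) ⟨?_, ?_⟩)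
    · change ι ≫ ρ ≫ k = 0
      rw [reassoc_of% h.w, zero_comp]
    · intro k k' hk
      have := congrArg Subtype.val hk
      dsimp only at this
      rwa [cancel_epi] at this
    · rintro ⟨s, hs⟩
      obtain ⟨k, hk⟩ := h.desc s hs
      exact ⟨k, Subtype.ext hk⟩
  have r4 : Nat.card {ξ : Ext Q K 1 // (Ext.mk₀ ι).comp ξ (zero_add 1) = η} = Nat.card g.range := by
    obtain ⟨ξ₀, h0⟩ := h.con₁' η h2
    symm
    refine Nat.card_congr (Equiv.ofBijective (fun k => ⟨ξ₀ + k.1, ?_⟩) ⟨?_, ?_⟩)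
    · obtain ⟨_, s, rfl⟩ := k
      rw [Ext.comp_add, h0]
      change η + (Ext.mk₀ ι).comp ((Ext.mk₀ ρ).comp s (zero_add 1)) (zero_add 1) = η
      rw [Ext.mk₀_comp_mk₀_assoc, h.w, Ext.mk₀_zero, Ext.zero_comp, add_zero]
    · intro k k' hk
      exact Subtype.ext (add_left_cancel (congrArg Subtype.val hk))
    · rintro ⟨s, hs⟩
      obtain ⟨k, hk⟩ := h.con₂ (s - ξ₀) (by
        rw [sub_eq_add_neg, Ext.comp_add, Ext.comp_neg, hs, h0, add_neg_cancel])
      exact ⟨⟨s - ξ₀, k, hk⟩, Subtype.ext (by simp)⟩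
  rw [r4, e1, e2, e3, r1, r2, r3]
  ring

/-- completions of a two-step extension -/
def Comp {K P Q : C} (κ : K ⟶ P) (θ : P ⟶ Q) (c : C) : Type :=
  {me : (P ⟶ c) × (c ⟶ Q) // SES (κ ≫ me.1) me.2 ∧ me.1 ≫ me.2 = θ}

theorem compCount (hfin : ∀ X Y : C, Finite (X ⟶ Y)) (hfinExt : ∀ X Y : C, Finite (Ext X Y 1))
    {K P I Q X : C} {κ : K ⟶ P} {π : P ⟶ I} {ι : I ⟶ Q} {ρ : Q ⟶ X}
    (h : SES κ π) (h' : SES ι ρ) (h2 : Subsingleton (Ext X K 2)) (T : Finset (IsoCl C))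
    (hT : ∀ c, Nonempty (Comp κ (π ≫ ι) c) → cl c ∈ T) :
    ∑ c ∈ T, (Nat.card (Comp κ (π ≫ ι) c.out) : ℚ) / autCard c.out =
      (Nat.card (Ext X K 1) : ℚ) / Nat.card (X ⟶ K) := by
  let Ξ := {ξ : Ext Q K 1 // (Ext.mk₀ ι).comp ξ (zero_add 1) = h.cls}
  have : Finite Ξ := by dsimp [Ξ]; infer_instance
  have := Fintype.ofFinite Ξ
  let Pt (c : C) (ξ : Ξ) := {p : (K ⟶ c) × (c ⟶ Q) // ∃ h : SES p.1 p.2, h.cls = ξ.1}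
  have e : ∀ c, Comp κ (π ≫ ι) c ≃
      Σ ξ : Ξ, Σ p : Pt c ξ, {m : P ⟶ c // κ ≫ m = p.1.1 ∧ m ≫ p.1.2 = π ≫ ι} := fun c =>
    { toFun := fun me => ⟨⟨me.2.1.cls, by
          have := h.natural me.2.1 (𝟙 K) me.1.1 ι (by simp) me.2.2
          rw [← this, Ext.comp_mk₀_id]⟩, ⟨(κ ≫ me.1.1, me.1.2), me.2.1, rfl⟩,
          ⟨me.1.1, rfl, me.2.2⟩⟩
      invFun := fun x => ⟨(x.2.2.1, x.2.1.1.2), by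
          obtain ⟨ξ, ⟨⟨j, e⟩, h3, _⟩, ⟨m, h4, h5⟩⟩ := x
          dsimp only at *
          rw [h4]
          exact ⟨h3, h5⟩⟩
      left_inv := fun me => rfl
      right_inv := by
        rintro ⟨⟨ξ, hξ⟩, ⟨⟨j, e⟩, h3, h6⟩, ⟨m, h4, h5⟩⟩
        dsimp only at h3 h6 h4 h5
        subst h4 h6
        rfl }
  have hc1 : ∀ c, (Nat.card (Comp κ (π ≫ ι) c) : ℚ) = ∑ ξ : Ξ, (Nat.card (Pt c ξ) : ℚ) * Nat.card (I ⟶ K) := by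
    intro c
    have hf1 : ∀ ξ : Ξ, Finite (Pt c ξ) := fun ξ => by dsimp [Pt]; infer_instance
    rw [Nat.card_congr (e c), Nat.card_sigma]
    push_cast
    refine Finset.sum_congr rfl (fun ξ _ => ?_)
    have := Fintype.ofFinite (Pt c ξ)
    rw [Nat.card_sigma, Finset.sum_congr rfl (g := fun _ => Nat.card (I ⟶ K))]
    · simp
    · rintro ⟨⟨j, e⟩, h3, h6⟩ _
      exact mCount h h3 ι (by rw [h6]; exact ξ.2)
  have hQK : (Nat.card (Q ⟶ K) : ℚ) ≠ 0 := by
    exact_mod_cast Nat.card_pos.ne'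
  have hXK : (Nat.card (X ⟶ K) : ℚ) ≠ 0 := by
    exact_mod_cast Nat.card_pos.ne'
  have hc2 : ∀ ξ : Ξ, ∑ c ∈ T, (Nat.card (Pt c.out ξ) : ℚ) / autCard c.out =
      1 / Nat.card (Q ⟶ K) := by
    intro ξ
    obtain ⟨c₀, j₀, e₀, h₀, hξ⟩ := SES.realize ξ.1
    have hm : cl c₀ ∈ T := by
      apply hT
      obtain ⟨m, h3, h4⟩ := h.exists_map h₀ ι (by rw [hξ]; exact ξ.2)
      exact ⟨⟨(m, e₀), by rw [h3]; exact ⟨h₀, h4⟩⟩⟩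
    rw [← isoSum hfin T c₀ hm, Finset.sum_div]
    refine Finset.sum_congr rfl (fun c _ => ?_)
    rw [extCount hfin h₀, hξ]
    change _ = ((Nat.card (Pt c.out ξ) * Nat.card (Q ⟶ K) : ℕ) : ℚ) / _ / _
    push_cast
    field_simp
  have hk := kerCount hfin h' h2 h.cls
  have hk' : (Nat.card Ξ : ℚ) * Nat.card (I ⟶ K) * Nat.card (X ⟶ K) =
    Nat.card (Ext X K 1) * Nat.card (Q ⟶ K) := by exact_mod_cast hk
  calc _ = ∑ ξ : Ξ, (∑ c ∈ T, (Nat.card (Pt c.out ξ) : ℚ) / autCard c.out) * Nat.card (I ⟶ K) := by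
        simp_rw [hc1, Finset.sum_div, Finset.sum_mul]
        rw [Finset.sum_comm]
        refine Finset.sum_congr rfl (fun ξ _ => Finset.sum_congr rfl (fun c _ => ?_))
        ring
    _ = Nat.card Ξ * Nat.card (I ⟶ K) / Nat.card (Q ⟶ K) := by
        simp_rw [hc2]
        simp [← Nat.card_eq_fintype_card]
        ring
    _ = _ := by
        field_simp
        linarith

end count

section geo
variable {C : Type} [SmallCategory C] [Abelian C]

theorem SES.quot_iso {b c a a' : C} {f : b ⟶ c} {g : c ⟶ a} {g' : c ⟶ a'} (h : SES f g)
    (h' : SES f g') : ∃ α : a ≅ a', g ≫ α.hom = g' := by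
  obtain ⟨s, hs⟩ := h.desc g' h'.w
  obtain ⟨r, hr⟩ := h'.desc g h.w
  have := h.epi
  have := h'.epi
  refine ⟨⟨s, r, ?_, ?_⟩, hs⟩
  · rw [← cancel_epi g, reassoc_of% hs, hr, Category.comp_id]
  · rw [← cancel_epi g', reassoc_of% hr, hs, Category.comp_id]

theorem SES.sub_iso {b b' c a : C} {f : b ⟶ c} {f' : b' ⟶ c} {g : c ⟶ a} (h : SES f g)
    (h' : SES f' g) : ∃ β : b ≅ b', β.hom ≫ f' = f := by
  obtain ⟨s, hs⟩ := h'.lift f h.w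
  obtain ⟨r, hr⟩ := h.lift f' h'.w
  have := h.mono
  have := h'.mono
  refine ⟨⟨s, r, ?_, ?_⟩, hs⟩
  · rw [← cancel_mono f, Category.assoc, hr, hs, Category.id_comp]
  · rw [← cancel_mono f', Category.assoc, hs, hr, Category.id_comp]

/-- short exact sequences with fixed terms -/
def E (a b c : C) : Type := {p : (b ⟶ c) × (c ⟶ a) // SES p.1 p.2}

theorem finE (hfin : ∀ X Y : C, Finite (X ⟶ Y)) (a b c : C) : Finite (E a b c) := by
  unfold E; infer_instance

theorem hallCount (hfin : ∀ X Y : C, Finite (X ⟶ Y)) (a b c : C) :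
    Nat.card (E a b c) = hall a b c * (autCard a * autCard b) := by
  have := finE hfin a b c
  have := finite_iso hfin
  let H := {S : Subobject c // Nonempty ((S : C) ≅ b) ∧ Nonempty ((cokernel S.arrow) ≅ a)}
  let F : (Σ S : H, (b ≅ (S.1 : C)) × (cokernel S.1.arrow ≅ a)) → E a b c := fun s =>
    ⟨(s.2.1.hom ≫ s.1.1.arrow, cokernel.π s.1.1.arrow ≫ s.2.2.hom), by
      simpa using (SES.of_mono (f := s.1.1.arrow) inferInstance).of_iso s.2.1 (Iso.refl _) s.2.2⟩
  have hF : Function.Bijective F := by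
    constructor
    · rintro ⟨⟨S, hS⟩, φ, ψ⟩ ⟨⟨S', hS'⟩, φ', ψ'⟩ h
      have h1 : φ.hom ≫ S.arrow = φ'.hom ≫ S'.arrow := congrArg (fun x => x.1.1) h
      have h2 : cokernel.π S.arrow ≫ ψ.hom = cokernel.π S'.arrow ≫ ψ'.hom :=
        congrArg (fun x => x.1.2) h
      have h3 : S = S' := by
        apply le_antisymm
        · exact Subobject.le_of_comm (φ.inv ≫ φ'.hom) (by
            rw [Category.assoc, ← h1, Iso.inv_hom_id_assoc])
        · exact Subobject.le_of_comm (φ'.inv ≫ φ.hom) (by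
            rw [Category.assoc, h1, Iso.inv_hom_id_assoc])
      subst h3
      rw [cancel_mono] at h1
      rw [cancel_epi] at h2
      rw [Iso.ext h1, Iso.ext h2]
    · rintro ⟨⟨i, p⟩, h⟩
      dsimp only at h
      have := h.mono
      have h2 : SES (Subobject.mk i).arrow p := by
        have := h.of_iso (Subobject.underlyingIso i) (Iso.refl _) (Iso.refl _)
        simpa using this
      obtain ⟨α, hα⟩ := (SES.of_mono (f := (Subobject.mk i).arrow) inferInstance).quot_iso h2
      refine ⟨⟨⟨Subobject.mk i, ⟨Subobject.underlyingIso i⟩, ⟨α⟩⟩,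
        (Subobject.underlyingIso i).symm, α⟩, ?_⟩
      apply Subtype.ext
      apply Prod.ext
      · simp [F]
      · exact hα
  have hfs := Finite.of_injective F hF.1
  have hH : Finite H := by
    refine Finite.of_surjective (fun s : (Σ S : H, (b ≅ (S.1 : C)) × (cokernel S.1.arrow ≅ a)) => s.1) ?_
    rintro ⟨S, ⟨h1⟩, ⟨h2⟩⟩
    exact ⟨⟨⟨S, ⟨h1⟩, ⟨h2⟩⟩, h1.symm, h2⟩, rfl⟩
  have := Fintype.ofFinite H
  rw [← Nat.card_congr (Equiv.ofBijective F hF), Nat.card_sigma,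
    Finset.sum_congr rfl (g := fun _ => autCard a * autCard b)]
  · simp [hall, H, ← Nat.card_eq_fintype_card]
  · rintro ⟨S, ⟨h1⟩, ⟨h2⟩⟩ _
    rw [Nat.card_prod, card_iso_self h1.symm, card_iso_self' h2, mul_comm]

/-- four term exact sequences -/
def Ex4 {y b a x : C} (u : y ⟶ b) (φ : b ⟶ a) (v : a ⟶ x) : Prop :=
  SES u (factorThruImage φ) ∧ SES (image.ι φ) v

namespace Ex4
variable {y b a x : C} {u : y ⟶ b} {φ : b ⟶ a} {v : a ⟶ x}

theorem mono (h : Ex4 u φ v) : Mono u := h.1.mono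
theorem epi (h : Ex4 u φ v) : Epi v := h.2.epi
theorem wl (h : Ex4 u φ v) : u ≫ φ = 0 := by
  rw [← image.fac φ, reassoc_of% h.1.w, zero_comp]
theorem wr (h : Ex4 u φ v) : φ ≫ v = 0 := by
  rw [← image.fac φ, Category.assoc, h.2.w, comp_zero]
theorem lift (h : Ex4 u φ v) {T : C} (t : T ⟶ b) (ht : t ≫ φ = 0) : ∃ s : T ⟶ y, s ≫ u = t :=
  h.1.lift t (by rw [← cancel_mono (image.ι φ)]; simpa using ht)
theorem cover (h : Ex4 u φ v) {T : C} (t : T ⟶ a) (ht : t ≫ v = 0) :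
    ∃ (T' : C) (p : T' ⟶ T) (_ : Epi p) (s : T' ⟶ b), p ≫ t = s ≫ φ := by
  obtain ⟨r, hr⟩ := h.2.lift t ht
  obtain ⟨T', p, hp, s, hs⟩ := surjective_up_to_refinements_of_epi (factorThruImage φ) r
  refine ⟨T', p, hp, s, ?_⟩
  rw [← hr, reassoc_of% hs, image.fac]

theorem mk' (hu : Mono u) (hv : Epi v) (w1 : u ≫ φ = 0) (w2 : φ ≫ v = 0)
    (hl : ∀ (T : C) (t : T ⟶ b), t ≫ φ = 0 →
      ∃ (T' : C) (π : T' ⟶ T) (_ : Epi π) (s : T' ⟶ y), π ≫ t = s ≫ u)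
    (hc : ∀ (T : C) (t : T ⟶ a), t ≫ v = 0 →
      ∃ (T' : C) (π : T' ⟶ T) (_ : Epi π) (s : T' ⟶ b), π ≫ t = s ≫ φ) : Ex4 u φ v := by
  constructor
  · refine SES.mk' hu inferInstance ?_ (fun T t ht => hl T t ?_)
    · rw [← cancel_mono (image.ι φ)]; simpa using w1
    · rw [← image.fac φ, reassoc_of% ht, zero_comp]
  · refine SES.mk' inferInstance hv ?_ (fun T t ht => ?_)
    · rw [← cancel_epi (factorThruImage φ)]; simpa using w2
    · obtain ⟨T', π, hπ, s, hs⟩ := hc T t ht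
      exact ⟨T', π, hπ, s ≫ factorThruImage φ, by simp [hs]⟩

theorem of_map (φ : b ⟶ a) : Ex4 (kernel.ι φ) φ (cokernel.π φ) := by
  refine mk' inferInstance inferInstance (kernel.condition φ) (cokernel.condition φ) ?_ ?_
  · intro T t ht
    exact ⟨T, 𝟙 T, inferInstance, kernel.lift φ t ht, by simp⟩
  · intro T t ht
    exact (ShortComplex.exact_iff_exact_up_to_refinements _).1 (ShortComplex.exact_cokernel φ) t ht
end Ex4

/-- frames -/
def Fr (b a y x : C) : Type :=
  {t : (y ⟶ b) × (b ⟶ a) × (a ⟶ x) // Ex4 t.1 t.2.1 t.2.2}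

theorem finFr (hfin : ∀ X Y : C, Finite (X ⟶ Y)) (b a y x : C) : Finite (Fr b a y x) := by
  unfold Fr; infer_instance

theorem frCount (hfin : ∀ X Y : C, Finite (X ⟶ Y)) (T : Finset (IsoCl C)) (b a y x : C)
    (hT : ∀ φ : b ⟶ a, cl (image φ) ∈ T) :
    ∑ z ∈ T, ((Nat.card (E z.out y b) : ℚ) * Nat.card (E x z.out a)) / autCard z.out =
      Nat.card (Fr b a y x) := by
  have := finFr hfin b a y x
  rw [← masterSum hfin T (fun f : Fr b a y x => image f.1.2.1)
    (fun z => E z y b × E x z a) ?_ (fun r => hT _)]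
  · simp
  · intro z
    symm
    refine Equiv.ofBijective (fun s => (⟨(s.1.1.1, factorThruImage s.1.1.2.1 ≫ s.2.inv), ?_⟩,
      ⟨(s.2.hom ≫ image.ι s.1.1.2.1, s.1.1.2.2), ?_⟩)) ⟨?_, ?_⟩
    · simpa using s.1.2.1.of_iso (Iso.refl _) (Iso.refl _) s.2.symm
    · simpa using s.1.2.2.of_iso s.2 (Iso.refl _) (Iso.refl _)
    · rintro ⟨⟨⟨u, φ, v⟩, h⟩, σ⟩ ⟨⟨⟨u', φ', v'⟩, h'⟩, σ'⟩ hh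
      have h1 : u = u' := congrArg (fun x => x.1.1.1) hh
      have h2 : v = v' := congrArg (fun x => x.2.1.2) hh
      have h3 : factorThruImage φ ≫ σ.inv = factorThruImage φ' ≫ σ'.inv :=
        congrArg (fun x => x.1.1.2) hh
      have h4 : σ.hom ≫ image.ι φ = σ'.hom ≫ image.ι φ' := congrArg (fun x => x.2.1.1) hh
      have h5 : φ = φ' := by
        have : (factorThruImage φ ≫ σ.inv) ≫ σ.hom ≫ image.ι φ =
          (factorThruImage φ' ≫ σ'.inv) ≫ σ'.hom ≫ image.ι φ' := by rw [h3, h4]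
        simpa using this
      subst h1 h2 h5
      rw [cancel_mono] at h4
      rw [Iso.ext h4]
    · rintro ⟨⟨⟨u, e⟩, h⟩, ⟨⟨m, v⟩, h'⟩⟩
      dsimp only at h h'
      have := h.epi
      have := h'.mono
      have : StrongEpi e := strongEpi_of_epi e
      let σ := image.isoStrongEpiMono e m rfl
      have hσ : σ.hom ≫ image.ι (e ≫ m) = m := image.isoStrongEpiMono_hom_comp_ι e m rfl
      have hσ' : factorThruImage (e ≫ m) ≫ σ.inv = e := by
        rw [Iso.comp_inv_eq, ← cancel_mono (image.ι (e ≫ m)), Category.assoc, hσ, image.fac]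
      refine ⟨⟨⟨(u, e ≫ m, v), ?_, ?_⟩, σ⟩, ?_⟩
      · have := h.of_iso (Iso.refl _) (Iso.refl _) σ
        dsimp only
        rw [Iso.comp_inv_eq] at hσ'
        rw [hσ']
        simpa using this
      · have := h'.of_iso σ.symm (Iso.refl _) (Iso.refl _)
        dsimp only
        rw [← Iso.eq_inv_comp] at hσ
        rw [hσ]
        simpa using this
      · apply Prod.ext
        · apply Subtype.ext
          apply Prod.ext
          · rfl
          · exact hσ'
        · apply Subtype.ext
          apply Prod.ext
          · exact hσ
          · rfl

end geo

section cross
variable {C : Type} [SmallCategory C] [Abelian C]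

theorem crossSES {y x a b a' c : C} {u : y ⟶ b} {φ : b ⟶ a'} {v : a' ⟶ x} (h : Ex4 u φ v)
    {v' : a ⟶ x} {i : b ⟶ c} {p : c ⟶ a} {p' : c ⟶ a'} (hp : Epi p) (hw : i ≫ p = 0)
    (hφ : i ≫ p' = φ) (hv : p ≫ v' = p' ≫ v) (hm : Mono (u ≫ i))
    (hl : ∀ (T : C) (t : T ⟶ c), t ≫ p = 0 → t ≫ p' = 0 → ∃ r, r ≫ u ≫ i = t) : SES i p := by
  refine SES.mk' ?_ hp hw ?_
  · apply Preadditive.mono_of_cancel_zero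
    intro T t ht
    obtain ⟨s, rfl⟩ := h.lift t (by rw [← hφ, reassoc_of% ht, zero_comp])
    have : s = 0 := by
      rw [← cancel_mono (u ≫ i), zero_comp, ← Category.assoc, ht]
    rw [this, zero_comp]
  · intro T t ht
    obtain ⟨T', q, hq, s, hs⟩ := h.cover (t ≫ p') (by
      rw [Category.assoc, ← hv, reassoc_of% ht, zero_comp])
    obtain ⟨r, hr⟩ := hl T' (q ≫ t - s ≫ i)
      (by rw [Preadditive.sub_comp, Category.assoc, Category.assoc, ht, hw]; simp)
      (by rw [Preadditive.sub_comp, Category.assoc, Category.assoc, hs, hφ, sub_self])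
    refine ⟨T', q, hq, s + r ≫ u, ?_⟩
    rw [Preadditive.add_comp, Category.assoc, hr]; simp

/-- crosses compatible with frames -/
def Cr {y x a b a' b' : C} (u : y ⟶ b) (φ : b ⟶ a') (v : a' ⟶ x) (u' : y ⟶ b') (ψ : b' ⟶ a)
    (v' : a ⟶ x) (c : C) : Type :=
  {q : ((b ⟶ c) × (c ⟶ a)) × ((b' ⟶ c) × (c ⟶ a')) // (SES q.1.1 q.1.2 ∧ SES q.2.1 q.2.2) ∧
    (q.1.1 ≫ q.2.2 = φ ∧ q.2.1 ≫ q.1.2 = ψ) ∧ u ≫ q.1.1 = u' ≫ q.2.1 ∧ q.1.2 ≫ v' = q.2.2 ≫ v}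

variable [HasExt.{0} C]

theorem crossMk {y x a b a' b' : C} {u : y ⟶ b} {φ : b ⟶ a'} {v : a' ⟶ x} (h : Ex4 u φ v)
    {u' : y ⟶ b'} {ψ : b' ⟶ a} {v' : a ⟶ x} (h' : Ex4 u' ψ v') :
    ∃ (θ : pushout u u' ⟶ pullback v' v),
      (∀ c, Nonempty (Cr u φ v u' ψ v' c ≃ Comp (u ≫ pushout.inl u u') θ c)) ∧
      SES (u ≫ pushout.inl u u') (factorThruImage θ) ∧
      SES (image.ι θ) (pullback.fst v' v ≫ v') := by
  have := h.mono
  have := h.epi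
  have := h'.mono
  have := h'.epi
  obtain ⟨l, hl1, hl2⟩ : ∃ l : b ⟶ pullback v' v, l ≫ pullback.fst v' v = 0 ∧
      l ≫ pullback.snd v' v = φ :=
    ⟨pullback.lift 0 φ (by rw [zero_comp, h.wr]), pullback.lift_fst _ _ _, pullback.lift_snd _ _ _⟩
  obtain ⟨l', hl1', hl2'⟩ : ∃ l : b' ⟶ pullback v' v, l ≫ pullback.fst v' v = ψ ∧
      l ≫ pullback.snd v' v = 0 :=
    ⟨pullback.lift ψ 0 (by rw [zero_comp, h'.wr]), pullback.lift_fst _ _ _, pullback.lift_snd _ _ _⟩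
  have hll : u ≫ l = u' ≫ l' := by
    apply pullback.hom_ext
    · rw [Category.assoc, Category.assoc, hl1, hl1', h'.wl, comp_zero]
    · rw [Category.assoc, Category.assoc, hl2, hl2', h.wl, comp_zero]
  obtain ⟨θ, hθ1, hθ2⟩ : ∃ θ : pushout u u' ⟶ pullback v' v, pushout.inl u u' ≫ θ = l ∧
      pushout.inr u u' ≫ θ = l' :=
    ⟨pushout.desc l l' hll, pushout.inl_desc _ _ _, pushout.inr_desc _ _ _⟩
  have hex : Ex4 (u ≫ pushout.inl u u') θ (pullback.fst v' v ≫ v') := by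
    refine Ex4.mk' inferInstance inferInstance ?_ ?_ ?_ ?_
    · rw [Category.assoc, hθ1]
      apply pullback.hom_ext
      · rw [Category.assoc, hl1, comp_zero, zero_comp]
      · rw [Category.assoc, hl2, h.wl, zero_comp]
    · apply pushout.hom_ext
      · rw [reassoc_of% hθ1, reassoc_of% hl1, comp_zero, zero_comp]
      · rw [reassoc_of% hθ2, reassoc_of% hl1', comp_zero, h'.wr]
    · intro T t ht
      obtain ⟨T', q, hq, y, z, hyz⟩ := pushout_cover u u' t
      have h1 : y ≫ l + z ≫ l' = 0 := by
        rw [← hθ1, ← hθ2, ← Category.assoc, ← Category.assoc, ← Preadditive.add_comp, ← hyz,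
          Category.assoc, ht, comp_zero]
      obtain ⟨s, hs⟩ := h.lift y (by
        have := h1 =≫ pullback.snd v' v
        simpa [hl2, hl2'] using this)
      obtain ⟨s', hs'⟩ := h'.lift z (by
        have := h1 =≫ pullback.fst v' v
        simpa [hl1, hl1'] using this)
      refine ⟨T', q, hq, s + s', ?_⟩
      rw [hyz, ← hs, ← hs', Preadditive.add_comp, Category.assoc, Category.assoc,
        pushout.condition]
    · intro T t ht
      obtain ⟨T₁, q₁, hq₁, z, hz⟩ := h'.cover (t ≫ pullback.fst v' v) (by
        rw [Category.assoc, ht])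
      obtain ⟨T₂, q₂, hq₂, y, hy⟩ := h.cover (q₁ ≫ t ≫ pullback.snd v' v) (by
        rw [Category.assoc, Category.assoc, ← pullback.condition, ht, comp_zero])
      refine ⟨T₂, q₂ ≫ q₁, inferInstance, y ≫ pushout.inl u u' + (q₂ ≫ z) ≫ pushout.inr u u', ?_⟩
      rw [Preadditive.add_comp, Category.assoc y, Category.assoc _ (pushout.inr u u'), hθ1, hθ2]
      apply pullback.hom_ext
      · simp only [Category.assoc, Preadditive.add_comp, hl1, hl1', hz, comp_zero, zero_add]
      · simp only [Category.assoc, Preadditive.add_comp, hl2, hl2', hy, comp_zero, add_zero]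
  refine ⟨θ, fun c => ⟨?_⟩, hex.1, hex.2⟩
  have hm : ∀ q : Cr u φ v u' ψ v' c, ∃ m : pushout u u' ⟶ c, pushout.inl u u' ≫ m = q.1.1.1 ∧
      pushout.inr u u' ≫ m = q.1.2.1 := fun q =>
    ⟨pushout.desc _ _ q.2.2.2.1, pushout.inl_desc _ _ _, pushout.inr_desc _ _ _⟩
  have he : ∀ q : Cr u φ v u' ψ v' c, ∃ e : c ⟶ pullback v' v,
      e ≫ pullback.fst v' v = q.1.1.2 ∧ e ≫ pullback.snd v' v = q.1.2.2 := fun q =>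
    ⟨pullback.lift _ _ q.2.2.2.2, pullback.lift_fst _ _ _, pullback.lift_snd _ _ _⟩
  choose m hm1 hm2 using hm
  choose e he1 he2 using he
  refine ⟨fun q => ⟨(m q, e q), ?_, ?_⟩, fun me => ⟨((pushout.inl u u' ≫ me.1.1,
    me.1.2 ≫ pullback.fst v' v), (pushout.inr u u' ≫ me.1.1, me.1.2 ≫ pullback.snd v' v)),
    ⟨?_, ?_⟩, ⟨?_, ?_⟩, ?_, ?_⟩, ?_, ?_⟩
  · dsimp only
    have k1 := hm1 q
    have k2 := he1 q
    have k3 := he2 q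
    obtain ⟨⟨⟨i, p⟩, ⟨i', p'⟩⟩, ⟨hs, hs'⟩, ⟨hφ, hψ⟩, hu, hv⟩ := q
    dsimp only at *
    generalize m _ = m at *
    generalize e _ = e at *
    rw [Category.assoc, k1]
    have := hs.mono
    have := hs.epi
    refine SES.mk' inferInstance ?_ ?_ ?_
    · rw [epi_iff_surjective_up_to_refinements]
      intro T t
      obtain ⟨T₁, q₁, hq₁, s, hs1⟩ := surjective_up_to_refinements_of_epi p (t ≫ pullback.fst v' v)
      obtain ⟨T₂, q₂, hq₂, z, hz⟩ := h.cover (q₁ ≫ t ≫ pullback.snd v' v - s ≫ p') (by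
        rw [Preadditive.sub_comp, Category.assoc, Category.assoc, Category.assoc, ← hv,
          ← pullback.condition, reassoc_of% hs1, sub_self])
      refine ⟨T₂, q₂ ≫ q₁, inferInstance, q₂ ≫ s + z ≫ i, ?_⟩
      apply pullback.hom_ext
      · simp only [Category.assoc, Preadditive.add_comp, k2, hs1, hs.w, comp_zero, add_zero]
      · simp only [Category.assoc, Preadditive.add_comp, k3, hφ, ← hz, Preadditive.comp_sub]
        abel
    · apply pullback.hom_ext
      · simp only [Category.assoc, k2, hs.w, comp_zero, zero_comp]
      · simp only [Category.assoc, k3, hφ, h.wl, zero_comp]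
    · intro T t ht
      obtain ⟨s, rfl⟩ := hs.lift t (by rw [← k2, reassoc_of% ht, zero_comp])
      obtain ⟨r, rfl⟩ := h.lift s (by
        rw [← hφ, ← k3, ← Category.assoc, ← Category.assoc, ht, zero_comp])
      exact ⟨T, 𝟙 T, inferInstance, r, by simp⟩
  · dsimp only
    apply pushout.hom_ext
    · rw [hθ1, reassoc_of% hm1]
      apply pullback.hom_ext
      · rw [Category.assoc, he1, hl1, q.2.1.1.w]
      · rw [Category.assoc, he2, hl2, q.2.2.1.1]
    · rw [hθ2, reassoc_of% hm2]
      apply pullback.hom_ext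
      · rw [Category.assoc, he1, hl1', q.2.2.1.2]
      · rw [Category.assoc, he2, hl2', q.2.1.2.w]
  · obtain ⟨⟨m, e⟩, hs, ht⟩ := me
    dsimp only at *
    have := hs.epi
    have := hs.mono
    rw [Category.assoc] at this
    refine crossSES h (v' := v') (p' := e ≫ pullback.snd v' v) inferInstance ?_ ?_ ?_ this ?_
    · rw [Category.assoc, reassoc_of% ht, reassoc_of% hθ1, hl1]
    · rw [Category.assoc, reassoc_of% ht, reassoc_of% hθ1, hl2]
    · rw [Category.assoc, Category.assoc, pullback.condition]
    · intro T t h1 h2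
      obtain ⟨r, hr⟩ := hs.lift t (by
        apply pullback.hom_ext
        · rw [Category.assoc, h1, zero_comp]
        · rw [Category.assoc, h2, zero_comp])
      exact ⟨r, by rw [← hr]; simp only [Category.assoc]⟩
  · obtain ⟨⟨m, e⟩, hs, ht⟩ := me
    dsimp only at *
    have := hs.epi
    rw [pushout.condition] at hs
    have := hs.mono
    rw [Category.assoc] at this
    refine crossSES h' (v' := v) (p' := e ≫ pullback.fst v' v) inferInstance ?_ ?_ ?_ this ?_
    · rw [Category.assoc, reassoc_of% ht, reassoc_of% hθ2, hl2']
    · rw [Category.assoc, reassoc_of% ht, reassoc_of% hθ2, hl1']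
    · rw [Category.assoc, Category.assoc, pullback.condition]
    · intro T t h1 h2
      obtain ⟨r, hr⟩ := hs.lift t (by
        apply pullback.hom_ext
        · rw [Category.assoc, h2, zero_comp]
        · rw [Category.assoc, h1, zero_comp])
      exact ⟨r, by rw [← hr]; simp only [Category.assoc]⟩
  · dsimp only
    rw [Category.assoc, reassoc_of% me.2.2, reassoc_of% hθ1, hl2]
  · dsimp only
    rw [Category.assoc, reassoc_of% me.2.2, reassoc_of% hθ2, hl1']
  · exact pushout.condition_assoc _
  · dsimp only
    rw [Category.assoc, Category.assoc, pullback.condition]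
  · intro q
    apply Subtype.ext
    apply Prod.ext
    · apply Prod.ext
      · exact hm1 q
      · exact he1 q
    · apply Prod.ext
      · exact hm2 q
      · exact he2 q
  · intro me
    apply Subtype.ext
    apply Prod.ext
    · apply pushout.hom_ext
      · exact hm1 _
      · exact hm2 _
    · apply pullback.hom_ext
      · exact he1 _
      · exact he2 _

open Abelian in
theorem crCount (hfin : ∀ X Y : C, Finite (X ⟶ Y))
    (hfinExt : ∀ X Y : C, Finite (Ext X Y 1)) (hered : ∀ X Y : C, Subsingleton (Ext X Y 2))
    {y x a b a' b' : C} {u : y ⟶ b} {φ : b ⟶ a'} {v : a' ⟶ x} (h : Ex4 u φ v)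
    {u' : y ⟶ b'} {ψ : b' ⟶ a} {v' : a ⟶ x} (h' : Ex4 u' ψ v') (T : Finset (IsoCl C))
    (hT : ∀ c, Nonempty (E a b c) → cl c ∈ T) :
    ∑ c ∈ T, (Nat.card (Cr u φ v u' ψ v' c.out) : ℚ) / autCard c.out =
      (ext1Card x y : ℚ) / homCard x y := by
  obtain ⟨θ, he, h1, h2⟩ := crossMk h h'
  have := compCount hfin hfinExt h1 h2 (hered _ _) T (fun c hc => by
    rw [Limits.image.fac] at hc
    obtain ⟨q⟩ := hc
    exact hT c ⟨⟨_, ((he c).some.symm q).2.1.1⟩⟩)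
  rw [Limits.image.fac] at this
  unfold ext1Card homCard
  rw [← this]
  refine Finset.sum_congr rfl (fun c _ => ?_)
  rw [Nat.card_congr (he c.out).some]

end cross

section final
variable {C : Type} [SmallCategory C]

theorem masterSum2 (hfin : ∀ X Y : C, Finite (X ⟶ Y)) (T : Finset (IsoCl C))
    {R : Type} [Finite R] (κ μ : R → C) (S : C → C → Type)
    (e : ∀ x y, S x y ≃ Σ r : R, (x ≅ κ r) × (y ≅ μ r))
    (hT : ∀ r, cl (κ r) ∈ T) (hT' : ∀ r, cl (μ r) ∈ T) :
    ∑ x ∈ T, ∑ y ∈ T, (Nat.card (S x.out y.out) : ℚ) / (autCard x.out * autCard y.out) =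
      Nat.card R := by
  have := Fintype.ofFinite R
  have := finite_iso hfin
  have h1 : ∀ x ∈ T, ∑ y ∈ T, (Nat.card (S x.out y.out) : ℚ) / (autCard x.out * autCard y.out) =
      ∑ r : R, (Nat.card (x.out ≅ κ r) : ℚ) / autCard x.out := by
    intro x _
    simp_rw [fun y => Nat.card_congr (e x.out y), Nat.card_sigma, Nat.cast_sum, Finset.sum_div]
    rw [Finset.sum_comm]
    refine Finset.sum_congr rfl (fun r _ => ?_)
    rw [← mul_one ((Nat.card (x.out ≅ κ r) : ℚ) / autCard x.out), ← isoSum hfin T (μ r) (hT' r),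
      Finset.mul_sum]
    refine Finset.sum_congr rfl (fun y _ => ?_)
    rw [Nat.card_prod]
    push_cast
    exact mul_div_mul_comm _ _ _ _
  rw [Finset.sum_congr rfl h1, Finset.sum_comm]
  simp_rw [fun r => isoSum hfin T (κ r) (hT r)]
  simp

variable [Abelian C]

theorem ex4_transfer {y x a b a' b' c : C} {i : b ⟶ c} {p : c ⟶ a} {i' : b' ⟶ c} {p' : c ⟶ a'}
    (h : SES i p) (h' : SES i' p') {u : y ⟶ b} {v : a' ⟶ x} (hf : Ex4 u (i ≫ p') v) :
    ∃ (u' : y ⟶ b') (v' : a ⟶ x), Ex4 u' (i' ≫ p) v' ∧ u ≫ i = u' ≫ i' ∧ p ≫ v' = p' ≫ v := by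
  have := h.mono
  have := h.epi
  have := h'.mono
  have := h'.epi
  have := hf.mono
  have := hf.epi
  obtain ⟨u', hu⟩ := h'.lift (u ≫ i) (by rw [Category.assoc, hf.wl])
  obtain ⟨v', hv⟩ := h.desc (p' ≫ v) (by rw [← Category.assoc, hf.wr])
  refine ⟨u', v', ?_, hu.symm, hv⟩
  refine Ex4.mk' ?_ ?_ ?_ ?_ ?_ ?_
  · have : Mono (u' ≫ i') := by rw [hu]; infer_instance
    exact mono_of_mono u' i'
  · have : Epi (p ≫ v') := by rw [hv]; infer_instance
    exact epi_of_epi p v'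
  · rw [← Category.assoc, hu, Category.assoc, h.w, comp_zero]
  · rw [Category.assoc, hv, reassoc_of% h'.w, zero_comp]
  · intro T t ht
    obtain ⟨s, hs⟩ := h.lift (t ≫ i') (by rw [Category.assoc, ht])
    obtain ⟨r, hr⟩ := hf.lift s (by rw [reassoc_of% hs, h'.w, comp_zero])
    refine ⟨T, 𝟙 T, inferInstance, r, ?_⟩
    rw [← cancel_mono i', Category.assoc, Category.assoc, Category.id_comp, hu, reassoc_of% hr, hs]
  · intro T t ht
    obtain ⟨T₁, q₁, hq₁, s, hs⟩ := surjective_up_to_refinements_of_epi p t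
    obtain ⟨T₂, q₂, hq₂, z, hz⟩ := hf.cover (s ≫ p') (by
      rw [Category.assoc, ← hv, ← Category.assoc, ← hs, Category.assoc, ht, comp_zero])
    obtain ⟨w, hw⟩ := h'.lift (q₂ ≫ s - z ≫ i) (by
      rw [Preadditive.sub_comp, Category.assoc, Category.assoc, hz, sub_self])
    refine ⟨T₂, q₂ ≫ q₁, inferInstance, w, ?_⟩
    rw [reassoc_of% hw, Preadditive.sub_comp, Category.assoc, Category.assoc, Category.assoc, hs,
      h.w, comp_zero, sub_zero]

/-- frame and isomorphisms with cokernel and kernel -/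
theorem frIso_bij {b a : C} (φ : b ⟶ a) (x y : C) :
    Function.Bijective (fun s : (x ≅ cokernel φ) × (y ≅ kernel φ) =>
      (⟨(s.2.hom ≫ kernel.ι φ, cokernel.π φ ≫ s.1.inv), by
        have h := Ex4.of_map φ
        exact ⟨by simpa using h.1.of_iso s.2 (Iso.refl _) (Iso.refl _),
          by simpa using h.2.of_iso (Iso.refl _) (Iso.refl _) s.1.symm⟩⟩ :
        {uv : (y ⟶ b) × (a ⟶ x) // Ex4 uv.1 φ uv.2})) := by
  constructor
  · rintro ⟨α, β⟩ ⟨α', β'⟩ h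
    have h1 : β.hom ≫ kernel.ι φ = β'.hom ≫ kernel.ι φ := congrArg (fun x => x.1.1) h
    have h2 : cokernel.π φ ≫ α.inv = cokernel.π φ ≫ α'.inv := congrArg (fun x => x.1.2) h
    rw [cancel_mono] at h1
    rw [cancel_epi] at h2
    rw [Iso.ext h1, Iso.ext_inv h2]
  · rintro ⟨⟨u, v⟩, h⟩
    dsimp only at h
    obtain ⟨β, hβ⟩ := h.1.sub_iso (Ex4.of_map φ).1
    obtain ⟨α, hα⟩ := (Ex4.of_map φ).2.quot_iso h.2
    exact ⟨(α.symm, β), Subtype.ext (Prod.ext hβ hα)⟩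

/-- decorated crosses -/
def Dec (a b a' b' c x y : C) : Type :=
  Σ f : Fr b a' y x × Fr b' a y x,
    Cr f.1.1.1 f.1.1.2.1 f.1.1.2.2 f.2.1.1 f.2.1.2.1 f.2.1.2.2 c

theorem decEquiv (a b a' b' c x y : C) :
    Nonempty (Dec a b a' b' c x y ≃ Σ r : E a b c × E a' b' c,
      (x ≅ cokernel (r.1.1.1 ≫ r.2.1.2)) × (y ≅ kernel (r.1.1.1 ≫ r.2.1.2))) := by
  let D1 := Σ r : E a b c × E a' b' c,
    {uv : (y ⟶ b) × (a' ⟶ x) // Ex4 uv.1 (r.1.1.1 ≫ r.2.1.2) uv.2}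
  have e1 : D1 ≃ Σ r : E a b c × E a' b' c,
      (x ≅ cokernel (r.1.1.1 ≫ r.2.1.2)) × (y ≅ kernel (r.1.1.1 ≫ r.2.1.2)) :=
    Equiv.sigmaCongrRight (fun r => (Equiv.ofBijective _ (frIso_bij (r.1.1.1 ≫ r.2.1.2) x y)).symm)
  let F : Dec a b a' b' c x y → D1 := fun d => ⟨(⟨d.2.1.1, d.2.2.1.1⟩, ⟨d.2.1.2, d.2.2.1.2⟩),
    ⟨(d.1.1.1.1, d.1.1.1.2.2), by
      have h1 := d.1.1.2
      have h2 := d.2.2.2.1.1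
      dsimp only at *
      rw [h2]
      exact h1⟩⟩
  have hF : Function.Bijective F := by
    constructor
    · rintro ⟨⟨⟨⟨u, φ, v⟩, hf⟩, ⟨⟨u', ψ, v'⟩, hf'⟩⟩, ⟨⟨⟨i, p⟩, ⟨i', p'⟩⟩, hs, ⟨hφ, hψ⟩, hu, hv⟩⟩
        ⟨⟨⟨⟨u2, φ2, v2⟩, hf2⟩, ⟨⟨u2', ψ2, v2'⟩, hf2'⟩⟩,
          ⟨⟨⟨i2, p2⟩, ⟨i2', p2'⟩⟩, hs2, ⟨hφ2, hψ2⟩, hu2, hv2⟩⟩ h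
      dsimp only at *
      have k1 : i = i2 := congrArg (fun d => d.1.1.1.1) h
      have k2 : p = p2 := congrArg (fun d => d.1.1.1.2) h
      have k3 : i' = i2' := congrArg (fun d => d.1.2.1.1) h
      have k4 : p' = p2' := congrArg (fun d => d.1.2.1.2) h
      have k5 : u = u2 := congrArg (fun d => d.2.1.1) h
      have k6 : v = v2 := congrArg (fun d => d.2.1.2) h
      subst k1 k2 k3 k4 k5 k6
      clear h
      have k9 : φ = φ2 := hφ.symm.trans hφ2
      have k10 : ψ = ψ2 := hψ.symm.trans hψ2
      have hu3 : u' ≫ i' = u2' ≫ i' := hu.symm.trans hu2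
      have hv3 : p ≫ v' = p ≫ v2' := hv.trans hv2.symm
      have : Epi p := hs.1.epi
      have : Mono i' := hs.2.mono
      have k7 : u' = u2' := by rw [← cancel_mono i', hu3]
      have k8 : v' = v2' := by rw [← cancel_epi p, hv3]
      subst k7 k8 k9 k10
      rfl
    · rintro ⟨⟨⟨⟨i, p⟩, h⟩, ⟨⟨i', p'⟩, h'⟩⟩, ⟨⟨u, v⟩, hf⟩⟩
      dsimp only at *
      obtain ⟨u', v', hf', hu, hv⟩ := ex4_transfer h h' hf
      exact ⟨⟨(⟨(u, i ≫ p', v), hf⟩, ⟨(u', i' ≫ p, v'), hf'⟩),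
        ⟨((i, p), (i', p')), ⟨h, h'⟩, ⟨rfl, rfl⟩, hu, hv⟩⟩, rfl⟩
  exact ⟨(Equiv.ofBijective F hF).trans e1⟩

theorem crossCount (hfin : ∀ X Y : C, Finite (X ⟶ Y)) (T : Finset (IsoCl C)) (a b a' b' c : C)
    (hT : ∀ φ : b ⟶ a', cl (cokernel φ) ∈ T) (hT' : ∀ φ : b ⟶ a', cl (kernel φ) ∈ T) :
    ∑ x ∈ T, ∑ y ∈ T,
      (Nat.card (Dec a b a' b' c x.out y.out) : ℚ) / (autCard x.out * autCard y.out) =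
      (Nat.card (E a b c) : ℚ) * Nat.card (E a' b' c) := by
  have := finE hfin
  rw [masterSum2 hfin T (R := E a b c × E a' b' c) (fun r => cokernel (r.1.1.1 ≫ r.2.1.2))
    (fun r => kernel (r.1.1.1 ≫ r.2.1.2)) (Dec a b a' b' c)
    (fun x y => (decEquiv a b a' b' c x y).some) (fun r => hT _) (fun r => hT' _)]
  simp

open Abelian in
theorem decCount [HasExt.{0} C] (hfin : ∀ X Y : C, Finite (X ⟶ Y))
    (hfinExt : ∀ X Y : C, Finite (Ext X Y 1)) (hered : ∀ X Y : C, Subsingleton (Ext X Y 2))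
    (a b a' b' x y : C) (T : Finset (IsoCl C)) (hT : ∀ c, Nonempty (E a b c) → cl c ∈ T) :
    ∑ c ∈ T, (Nat.card (Dec a b a' b' c.out x y) : ℚ) / autCard c.out =
      (Nat.card (Fr b a' y x) : ℚ) * Nat.card (Fr b' a y x) *
        ((ext1Card x y : ℚ) / homCard x y) := by
  have := finFr hfin
  have := Fintype.ofFinite (Fr b a' y x × Fr b' a y x)
  have : ∀ (f : Fr b a' y x × Fr b' a y x) c,
      Finite (Cr f.1.1.1 f.1.1.2.1 f.1.1.2.2 f.2.1.1 f.2.1.2.1 f.2.1.2.2 c) := by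
    intro f c; unfold Cr; infer_instance
  simp_rw [Dec, Nat.card_sigma, Nat.cast_sum, Finset.sum_div]
  rw [Finset.sum_comm, Finset.sum_congr rfl (fun f _ =>
    crCount hfin hfinExt hered f.1.2 f.2.2 T hT)]
  simp [← Nat.card_eq_fintype_card]

open Abelian in
theorem exists_T [HasExt.{0} C] (hfin : ∀ X Y : C, Finite (X ⟶ Y))
    (hfinExt : ∀ X Y : C, Finite (Ext X Y 1)) (a b a' b' : C) :
    ∃ T : Finset (IsoCl C), (∀ c, Nonempty (E a b c) → cl c ∈ T) ∧
      (∀ φ : b ⟶ a', cl (cokernel φ) ∈ T) ∧ (∀ φ : b ⟶ a', cl (kernel φ) ∈ T) ∧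
      (∀ φ : b ⟶ a', cl (Limits.image φ) ∈ T) ∧ (∀ φ : b' ⟶ a, cl (Limits.image φ) ∈ T) := by
  classical
  have f1 := Set.finite_range (fun ξ : Ext a b 1 => cl (SES.realize ξ).choose)
  have f2 := Set.finite_range (fun φ : b ⟶ a' => cl (cokernel φ))
  have f3 := Set.finite_range (fun φ : b ⟶ a' => cl (kernel φ))
  have f4 := Set.finite_range (fun φ : b ⟶ a' => cl (Limits.image φ))
  have f5 := Set.finite_range (fun φ : b' ⟶ a => cl (Limits.image φ))
  have hu := f1.union (f2.union (f3.union (f4.union f5)))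
  refine ⟨hu.toFinset, ?_, ?_, ?_, ?_, ?_⟩
  · rintro c ⟨⟨⟨i, p⟩, h⟩⟩
    dsimp only at h
    rw [Set.Finite.mem_toFinset]
    refine Or.inl ⟨h.cls, ?_⟩
    obtain ⟨j, e, h2, h3⟩ := (SES.realize h.cls).choose_spec
    obtain ⟨m, -, -⟩ := h2.exists_iso h h3
    exact (cl_eq_iff _ _).2 ⟨m⟩
  all_goals
    intro φ
    rw [Set.Finite.mem_toFinset]
  · exact Or.inr (Or.inl ⟨φ, rfl⟩)
  · exact Or.inr (Or.inr (Or.inl ⟨φ, rfl⟩))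
  · exact Or.inr (Or.inr (Or.inr (Or.inl ⟨φ, rfl⟩)))
  · exact Or.inr (Or.inr (Or.inr (Or.inr ⟨φ, rfl⟩)))

theorem E_nonempty (hfin : ∀ X Y : C, Finite (X ⟶ Y)) {a b c : C} (h : (hall a b c : ℚ) ≠ 0) :
    Nonempty (E a b c) := by
  have h1 : hall a b c ≠ 0 := by exact_mod_cast h
  have h2 : Nat.card (E a b c) ≠ 0 := by
    rw [hallCount hfin]
    exact mul_ne_zero h1 (mul_ne_zero (autCard_pos hfin _).ne' (autCard_pos hfin _).ne')
  by_contra h3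
  rw [not_nonempty_iff] at h3
  exact h2 (by simp)

theorem mem_of_E {T : Finset (IsoCl C)} {x y y' b a : C} (h1 : Nonempty (E y y' b))
    (h2 : Nonempty (E x y a)) (φT : ∀ φ : b ⟶ a, cl (cokernel φ) ∈ T)
    (φT' : ∀ φ : b ⟶ a, cl (kernel φ) ∈ T) : cl x ∈ T ∧ cl y' ∈ T := by
  obtain ⟨⟨⟨u, e⟩, h⟩⟩ := h1
  obtain ⟨⟨⟨m, v⟩, h'⟩⟩ := h2
  dsimp only at h h'
  have := h.epi
  have := h'.mono
  have hx : Ex4 u (e ≫ m) v := by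
    refine Ex4.mk' h.mono h'.epi ?_ ?_ ?_ ?_
    · rw [reassoc_of% h.w, zero_comp]
    · rw [Category.assoc, h'.w, comp_zero]
    · intro T t ht
      obtain ⟨s, hs⟩ := h.lift t (by rw [← cancel_mono m, Category.assoc, ht, zero_comp])
      exact ⟨T, 𝟙 T, inferInstance, s, by simp [hs]⟩
    · intro T t ht
      obtain ⟨s, hs⟩ := h'.lift t ht
      obtain ⟨T', q, hq, r, hr⟩ := surjective_up_to_refinements_of_epi e s
      exact ⟨T', q, hq, r, by rw [← hs, reassoc_of% hr]⟩
  obtain ⟨⟨α, β⟩, -⟩ := (frIso_bij (e ≫ m) x y').2 ⟨(u, v), hx⟩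
  rw [(cl_eq_iff _ _).2 ⟨α⟩, (cl_eq_iff _ _).2 ⟨β⟩]
  exact ⟨φT _, φT' _⟩

theorem mem_of_E' {T : Finset (IsoCl C)} {x y y' b a : C} (h1 : Nonempty (E y y' b))
    (h2 : Nonempty (E x y a)) (φT : ∀ φ : b ⟶ a, cl (Limits.image φ) ∈ T) : cl y ∈ T := by
  obtain ⟨⟨⟨u, e⟩, h⟩⟩ := h1
  obtain ⟨⟨⟨m, v⟩, h'⟩⟩ := h2
  dsimp only at h h'
  have := h.epi
  have := h'.mono
  have : StrongEpi e := strongEpi_of_epi e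
  rw [(cl_eq_iff _ _).2 ⟨image.isoStrongEpiMono e m rfl⟩]
  exact φT _

theorem finsum4 {ι : Type} (T : Finset ι) (f : ι → ι → ι → ι → ℚ)
    (h : ∀ x y x' y', f x y x' y' ≠ 0 → x ∈ T ∧ y ∈ T ∧ x' ∈ T ∧ y' ∈ T) :
    ∑ᶠ x, ∑ᶠ y, ∑ᶠ x', ∑ᶠ y', f x y x' y' =
      ∑ x ∈ T, ∑ y ∈ T, ∑ x' ∈ T, ∑ y' ∈ T, f x y x' y' := by
  have e4 : ∀ x y x', ∑ᶠ y', f x y x' y' = ∑ y' ∈ T, f x y x' y' := fun x y x' =>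
    finsum_eq_sum_of_support_subset _ (fun y' hy => (h x y x' y' hy).2.2.2)
  simp_rw [e4]
  have e3 : ∀ x y, ∑ᶠ x', ∑ y' ∈ T, f x y x' y' = ∑ x' ∈ T, ∑ y' ∈ T, f x y x' y' := fun x y =>
    finsum_eq_sum_of_support_subset _ (fun x' hx => by
      obtain ⟨y', _, hy⟩ := Finset.exists_ne_zero_of_sum_ne_zero hx
      exact (h x y x' y' hy).2.2.1)
  simp_rw [e3]
  have e2 : ∀ x, ∑ᶠ y, ∑ x' ∈ T, ∑ y' ∈ T, f x y x' y' = ∑ y ∈ T, ∑ x' ∈ T, ∑ y' ∈ T, f x y x' y' :=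
    fun x => finsum_eq_sum_of_support_subset _ (fun y hx => by
      obtain ⟨x', _, hx⟩ := Finset.exists_ne_zero_of_sum_ne_zero hx
      obtain ⟨y', _, hy⟩ := Finset.exists_ne_zero_of_sum_ne_zero hx
      exact (h x y x' y' hy).2.1)
  simp_rw [e2]
  exact finsum_eq_sum_of_support_subset _ (fun x hx => by
    obtain ⟨y, _, hx⟩ := Finset.exists_ne_zero_of_sum_ne_zero hx
    obtain ⟨x', _, hx⟩ := Finset.exists_ne_zero_of_sum_ne_zero hx
    obtain ⟨y', _, hy⟩ := Finset.exists_ne_zero_of_sum_ne_zero hx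
    exact (h x y x' y' hy).1)

end final

/-- **Green's formula.** -/
theorem greens_formula
    (k : Type) [Field k] [Fintype k]
    (A : Type) [SmallCategory A] [Abelian A] [CategoryTheory.Linear k A]
    [HasExt.{0} A]
    -- finitary: finite Hom-sets and finite Ext¹-groups
    (hfinHom : ∀ X Y : A, Finite (X ⟶ Y))
    (hfinExt : ∀ X Y : A, Finite (Abelian.Ext X Y 1))
    -- hereditary: Ext² vanishes identically
    (hered : ∀ X Y : A, Subsingleton (Abelian.Ext X Y 2))
    (a b a' b' : A) :
    (autCard a * autCard b * autCard a' * autCard b' : ℚ) *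
        ∑ᶠ c : IsoCl A, (hall a b c.out : ℚ) * (hall a' b' c.out : ℚ) / (autCard c.out : ℚ)
      = ∑ᶠ x : IsoCl A, ∑ᶠ y : IsoCl A, ∑ᶠ x' : IsoCl A, ∑ᶠ y' : IsoCl A,
          ((ext1Card x.out y'.out : ℚ) / (homCard x.out y'.out : ℚ)) *
            (hall x.out x'.out a : ℚ) * (hall y.out y'.out b : ℚ) *
            (hall x.out y.out a' : ℚ) * (hall x'.out y'.out b' : ℚ) *
            (autCard x.out : ℚ) * (autCard y.out : ℚ) *
            (autCard x'.out : ℚ) * (autCard y'.out : ℚ) := by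
  obtain ⟨T, hc, hcok, hker, him, him'⟩ := exists_T hfinHom hfinExt a b a' b'
  have hE : ∀ a b c : A, (Nat.card (E a b c) : ℚ) = hall a b c * (autCard a * autCard b) :=
    fun a b c => by rw [hallCount hfinHom]; push_cast; rfl
  have hpos : ∀ x : A, (autCard x : ℚ) ≠ 0 := fun x => by
    exact_mod_cast (autCard_pos hfinHom x).ne'
  rw [finsum_eq_sum_of_support_subset (s := T) _ (fun c hh => by
    have h1 : (hall a b c.out : ℚ) ≠ 0 := by
      intro h0
      exact hh (by simp [h0])
    have := hc _ (E_nonempty hfinHom h1)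
    rwa [cl_out] at this)]
  rw [finsum4 T _ (fun x y x' y' hh => by
    have h1 : (hall x.out x'.out a : ℚ) ≠ 0 := by intro h0; exact hh (by simp [h0])
    have h2 : (hall y.out y'.out b : ℚ) ≠ 0 := by intro h0; exact hh (by simp [h0])
    have h3 : (hall x.out y.out a' : ℚ) ≠ 0 := by intro h0; exact hh (by simp [h0])
    have h4 : (hall x'.out y'.out b' : ℚ) ≠ 0 := by intro h0; exact hh (by simp [h0])
    have m1 := mem_of_E (E_nonempty hfinHom h2) (E_nonempty hfinHom h3) hcok hker
    have m2 := mem_of_E' (E_nonempty hfinHom h2) (E_nonempty hfinHom h3) him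
    have m3 := mem_of_E' (E_nonempty hfinHom h4) (E_nonempty hfinHom h1) him'
    rw [cl_out] at m2 m3
    rw [cl_out, cl_out] at m1
    exact ⟨m1.1, m2, m3, m1.2⟩)]
  have L : (autCard a * autCard b * autCard a' * autCard b' : ℚ) *
      ∑ c ∈ T, (hall a b c.out : ℚ) * (hall a' b' c.out : ℚ) / (autCard c.out : ℚ) =
      ∑ x ∈ T, ∑ y' ∈ T, (Nat.card (Fr b a' y'.out x.out) : ℚ) * Nat.card (Fr b' a y'.out x.out) *
        ((ext1Card x.out y'.out : ℚ) / homCard x.out y'.out) /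
          (autCard x.out * autCard y'.out) := by
    calc _ = ∑ c ∈ T, ((Nat.card (E a b c.out) : ℚ) * Nat.card (E a' b' c.out)) /
          autCard c.out := by
          rw [Finset.mul_sum]
          refine Finset.sum_congr rfl (fun c _ => ?_)
          rw [hE, hE]
          ring
      _ = ∑ c ∈ T, ∑ x ∈ T, ∑ y ∈ T, (Nat.card (Dec a b a' b' c.out x.out y.out) : ℚ) /
            autCard c.out / (autCard x.out * autCard y.out) := by
          refine Finset.sum_congr rfl (fun c _ => ?_)
          rw [← crossCount hfinHom T a b a' b' c.out hcok hker, Finset.sum_div]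
          refine Finset.sum_congr rfl (fun x _ => ?_)
          rw [Finset.sum_div]
          exact Finset.sum_congr rfl (fun y _ => div_right_comm _ _ _)
      _ = _ := by
          rw [Finset.sum_comm]
          refine Finset.sum_congr rfl (fun x _ => ?_)
          rw [Finset.sum_comm]
          refine Finset.sum_congr rfl (fun y _ => ?_)
          rw [← Finset.sum_div, decCount hfinHom hfinExt hered _ _ _ _ _ _ T hc]
  rw [L]
  refine Finset.sum_congr rfl (fun x _ => ?_)
  calc _ = ∑ y' ∈ T, ∑ y ∈ T, ∑ x' ∈ T,
          (((Nat.card (E y.out y'.out b) : ℚ) * Nat.card (E x.out y.out a')) / autCard y.out) *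
          (((Nat.card (E x'.out y'.out b') : ℚ) * Nat.card (E x.out x'.out a)) / autCard x'.out) *
          ((ext1Card x.out y'.out : ℚ) / homCard x.out y'.out) /
            (autCard x.out * autCard y'.out) := by
        refine Finset.sum_congr rfl (fun y' _ => ?_)
        rw [← frCount hfinHom T b a' y'.out x.out him, ← frCount hfinHom T b' a y'.out x.out him',
          Finset.sum_mul_sum, Finset.sum_mul, Finset.sum_div]
        refine Finset.sum_congr rfl (fun y _ => ?_)
        rw [Finset.sum_mul, Finset.sum_div]
    _ = _ := by
        rw [Finset.sum_comm]
        refine Finset.sum_congr rfl (fun y _ => ?_)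
        rw [Finset.sum_comm]
        refine Finset.sum_congr rfl (fun x' _ => Finset.sum_congr rfl (fun y' _ => ?_))
        simp only [hE]
        have n1 := hpos x.out
        have n2 := hpos y.out
        have n3 := hpos x'.out
        have n4 := hpos y'.out
        generalize (ext1Card x.out y'.out : ℚ) / homCard x.out y'.out = q
        field_simp

end GreenDH
end
end

section
/- Let A be a hereditary abelian category, let t ≥ 0 (with the convention Z_0 = Z), and let M^• = (M^i, d^i)_{i ∈ Z_t} be a t-periodic (resp. bounded, if t = 0) complex over A. Then M^• is isomorphic in the relative derived category D_t(A) to the direct sum over i ∈ Z_t of the stalk complexes Z^{[i]}_{H^i(M^•)}, where H^i(M^•) = Ker(d^i)/Im(d^{i-1}) is the i-th homology of M^•. -/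
/-!
STATEMENT 2.
Let `A` be a hereditary abelian category and `t ≥ 0` (with the convention `Z_0 = ℤ`,
realized here as `ZMod 0 = ℤ`).  Any `t`-periodic complex `M` (bounded if `t = 0`)
becomes isomorphic, in the relative derived category `D_t(A)` (encoded as any
localization `L : C_t(A) ⥤ E` of the category of `t`-periodic complexes at the
quasi-isomorphisms), to the direct sum over `i ∈ Z_t` of the stalk complexes
`Z^{[i]}_{H^i(M)}`, i.e. to the complex with components `H^i(M)` and zero differentials.
-/

open CategoryTheory CategoryTheory.Limits

noncomputable section

namespace GreenDH

/-- The shape of `t`-periodic complexes (`ℤ`-indexed cochain complexes when `t = 0`). -/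
def pShape (t : ℕ) : ComplexShape (ZMod t) := ComplexShape.up' (1 : ZMod t)

/-- The category `C_t(A)` of `t`-periodic complexes over `A`. -/
abbrev Ct (A : Type) [SmallCategory A] [Abelian A] (t : ℕ) :=
  HomologicalComplex A (pShape t)

/-- The `t`-periodic complex with prescribed components and zero differentials. -/
def mkZero {A : Type} [SmallCategory A] [Abelian A] {t : ℕ} (f : ZMod t → A) : Ct A t where
  X := f
  d _ _ := 0
  shape _ _ _ := rfl
  d_comp_d' := by intros; simp

/-- The direct sum `⊕_{i ∈ Z_t} Z^{[i]}_{H^i(M)}` of the stalk complexes on the homologies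
of `M`: the complex whose `i`-th component is `H^i(M)` and whose differentials vanish. -/
def homologyCx {A : Type} [SmallCategory A] [Abelian A] {t : ℕ} (M : Ct A t) : Ct A t :=
  mkZero (fun i => M.homology i)

theorem factor_aux {A : Type*} [Category A] [Abelian A] {D : Type*} [Category D]
    (s : A ⥤ D) (F : D ⥤ A) (η : s ⋙ F ≅ 𝟭 A) (S : ShortComplex A) (T : D)
    (a : s.obj S.X₁ ⟶ T) (b : T ⟶ s.obj S.X₃) (c : T ⟶ s.obj S.X₂)
    (hc₁ : a ≫ c = s.map S.f) (hc₂ : b = c ≫ s.map S.g)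
    (w0 : F.map a ≫ F.map b = 0)
    (ses : (ShortComplex.mk (F.map a) (F.map b) w0).ShortExact) :
    ∃ (E : A) (j : S.X₁ ⟶ E) (r : E ⟶ S.X₃) (g : E ⟶ S.X₂) (w : j ≫ r = 0),
      j ≫ g = S.f ∧ g ≫ S.g = r ∧ (ShortComplex.mk j r w).ShortExact := by
  let e (X : A) : F.obj (s.obj X) ≅ X := η.app X
  have nat {X Y : A} (f : X ⟶ Y) : F.map (s.map f) ≫ (e Y).hom = (e X).hom ≫ f :=
    η.hom.naturality f
  refine ⟨F.obj T, (e _).inv ≫ F.map a, F.map b ≫ (e _).hom, F.map c ≫ (e _).hom, ?_,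
    ?_, ?_, ?_⟩
  · simp [reassoc_of% w0]
  · rw [Category.assoc, ← F.map_comp_assoc, hc₁, nat]
    simp
  · rw [Category.assoc, ← nat, hc₂, F.map_comp, Category.assoc]
  · refine ShortComplex.shortExact_of_iso
      (ShortComplex.isoMk
        (S₁ := ShortComplex.mk (F.map a) (F.map b) w0) (e S.X₁) (Iso.refl _) (e S.X₃) ?_ ?_) ses
    · simp
    · simp

/-- In a hereditary category, a right exact `X ⟶ Y ⟶ C` lifts to a short exact `X ⟶ E ⟶ C`. -/
theorem factor {A : Type} [SmallCategory A] [Abelian A] [HasExt.{0} A]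
    (hered : ∀ X Y : A, Subsingleton (Abelian.Ext X Y 2))
    (S : ShortComplex A) (hS : S.Exact) [Epi S.g] :
    ∃ (E : A) (j : S.X₁ ⟶ E) (r : E ⟶ S.X₃) (g : E ⟶ S.X₂) (w : j ≫ r = 0),
      j ≫ g = S.f ∧ g ≫ S.g = r ∧ (ShortComplex.mk j r w).ShortExact := by
  let _ : HasDerivedCategory A := HasDerivedCategory.standard A
  let p : S.X₁ ⟶ kernel S.g := kernel.lift S.g S.f S.zero
  have hp : Epi p := by
    exact hS.epi_kernelLift
  let T₁ : ShortComplex A := ShortComplex.mk (kernel.ι p) p (by simp)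
  have hT₁ : T₁.ShortExact :=
    { exact := ShortComplex.exact_of_f_is_kernel _ (kernelIsKernel p)
      mono_f := by dsimp [T₁]; infer_instance
      epi_g := hp }
  let T₂ : ShortComplex A := ShortComplex.mk (kernel.ι S.g) S.g (by simp)
  have hT₂ : T₂.ShortExact :=
    { exact := ShortComplex.exact_of_f_is_kernel _ (kernelIsKernel S.g)
      mono_f := by dsimp [T₂]; infer_instance
      epi_g := by dsimp [T₂]; infer_instance }
  obtain ⟨x, hx⟩ := Abelian.Ext.covariant_sequence_exact₃ S.X₃ hT₁ (n₀ := 1) (n₁ := 2)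
    hT₂.extClass rfl ((hered _ _).elim _ _)
  obtain ⟨T, a, b, hT⟩ := Pretriangulated.distinguished_cocone_triangle₂
    (Z := (DerivedCategory.singleFunctor A 0).obj S.X₃)
    (X := (DerivedCategory.singleFunctor A 0).obj S.X₁) x.hom
  obtain ⟨c, hc₁, hc₂⟩ := Pretriangulated.complete_distinguished_triangle_morphism₂ _ _
    hT hT₂.singleTriangle_distinguished ((DerivedCategory.singleFunctor A 0).map p)
    (𝟙 _) (by
      have := congrArg Abelian.Ext.hom hx
      rw [← Abelian.Ext.hom_comp_singleFunctor_map_shift] at this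
      rw [ShortComplex.ShortExact.extClass_hom] at this
      refine this.trans ?_
      exact (Category.id_comp _).symm)
  let F := DerivedCategory.homologyFunctor A 0
  change a ≫ c = (DerivedCategory.singleFunctor A 0).map p ≫
    (DerivedCategory.singleFunctor A 0).map (kernel.ι S.g) at hc₁
  change b ≫ 𝟙 _ = c ≫ (DerivedCategory.singleFunctor A 0).map S.g at hc₂
  rw [← Functor.map_comp, kernel.lift_ι] at hc₁
  rw [Category.comp_id] at hc₂
  have w0 : F.map a ≫ F.map b = 0 := by
    have := Pretriangulated.comp_distTriang_mor_zero₁₂ _ hT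
    change a ≫ b = 0 at this
    rw [← F.map_comp, this, F.map_zero]
  have ses : (ShortComplex.mk (F.map a) (F.map b) w0).ShortExact :=
    { exact := DerivedCategory.HomologySequence.exact₂ _ hT 0
      mono_f := by
        refine (DerivedCategory.HomologySequence.mono_homologyMap_mor₁_iff _ hT (-1) 0).2 ?_
        apply IsZero.eq_of_src
        exact DerivedCategory.isZero_of_isGE _ 0 (-1) (by lia)
          (hX := inferInstanceAs (((DerivedCategory.singleFunctor A 0).obj _).IsGE 0))
      epi_g := by
        refine (DerivedCategory.HomologySequence.epi_homologyMap_mor₂_iff _ hT 0 1).2 ?_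
        apply IsZero.eq_of_tgt
        exact DerivedCategory.isZero_of_isLE _ 0 1 (by lia)
          (hX := inferInstanceAs (((DerivedCategory.singleFunctor A 0).obj _).IsLE 0)) }
  exact factor_aux (DerivedCategory.singleFunctor A 0) F
    (DerivedCategory.singleFunctorCompHomologyFunctorIso A 0) S T a b c hc₁ hc₂ w0 ses

theorem pShape_rel_prev (t : ℕ) (i : ZMod t) : (pShape t).Rel ((pShape t).prev i) i := by
  have h : (pShape t).Rel (i - 1) i := sub_add_cancel i 1
  rw [(pShape t).prev_eq' h]
  exact h

/-- The termwise data: extensions `E` of `H^i(M)` by `M^{i-1}` over the cycles. -/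
theorem exists_data {A : Type} [SmallCategory A] [Abelian A] [HasExt.{0} A]
    (hered : ∀ X Y : A, Subsingleton (Abelian.Ext X Y 2)) {t : ℕ} (M : Ct A t) (k : ZMod t) :
    ∃ (E : A) (j : ∀ i, M.X i ⟶ E) (r : E ⟶ M.homology k) (g : E ⟶ M.cycles k)
      (w : ∀ i, j i ≫ r = 0),
      (∀ i, j i ≫ g = M.toCycles i k) ∧ g ≫ M.homologyπ k = r ∧
      (∀ i, ¬ (pShape t).Rel i k → j i = 0) ∧
      (∀ i, (pShape t).Rel i k → (ShortComplex.mk (j i) r (w i)).ShortExact) := by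
  classical
  obtain ⟨p, hp⟩ : ∃ p, (pShape t).Rel p k := ⟨_, pShape_rel_prev t k⟩
  let S : ShortComplex A := ShortComplex.mk (M.toCycles p k) (M.homologyπ k) (by simp)
  have hS : S.Exact := ShortComplex.exact_of_g_is_cokernel _
    (M.homologyIsCokernel p k ((pShape t).prev_eq' hp))
  have : Epi S.g := by dsimp [S]; infer_instance
  obtain ⟨E, j, r, g, w, h₁, h₂, h₃⟩ := factor hered S hS
  change j ≫ g = M.toCycles p k at h₁
  have hz : ∀ i, i ≠ p → ¬ (pShape t).Rel i k := fun i hi h =>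
    hi ((pShape t).prev_eq h hp)
  refine ⟨E, fun i => if h : i = p then eqToHom (by rw [h]) ≫ j else 0, r, g, ?_, ?_, h₂, ?_, ?_⟩
  · intro i
    dsimp only
    split_ifs with h
    · rw [Category.assoc, w, comp_zero]
    · simp
  · intro i
    dsimp only
    split_ifs with h
    · subst h
      simp [h₁]
    · rw [M.toCycles_eq_zero (hz i h), zero_comp]
  · intro i hi
    dsimp only
    rw [dif_neg]
    rintro rfl
    exact hi hp
  · intro i hi
    obtain rfl : i = p := (pShape t).prev_eq hi hp
    simpa using h₃

theorem sc_quasiIso {A : Type*} [Category A] [Abelian A] {S S' : ShortComplex A} (φ : S ⟶ S')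
    (h' : S'.LeftHomologyData) {K H : A} (i : K ⟶ S.X₂) (f' : S.X₁ ⟶ K) (r : K ⟶ H) [Epi r]
    (hm : Mono i) (hf : f' ≫ i = S.f) (hi : i ≫ S.g = 0)
    (hl : ∀ (W : A) (x : W ⟶ S.X₂), x ≫ S.g = 0 → ∃ y : W ⟶ K, y ≫ i = x)
    (hr : f' ≫ r = 0)
    (hc : ∀ (W : A) (x : K ⟶ W), f' ≫ x = 0 → ∃ y : H ⟶ W, r ≫ y = x)
    (φK : K ⟶ h'.K) (φH : H ⟶ h'.H) (hiso : IsIso φH)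
    (h₁ : φK ≫ h'.i = i ≫ φ.τ₂) (h₂ : r ≫ φH = φK ≫ h'.π) : ShortComplex.QuasiIso φ := by
  let lim : IsLimit (KernelFork.ofι i hi) :=
    KernelFork.IsLimit.ofι' _ _ (fun {W} x hx => ⟨(hl W x hx).choose, (hl W x hx).choose_spec⟩)
  have e : lim.lift (KernelFork.ofι _ S.zero) = f' := by
    rw [← cancel_mono i, hf]
    exact Fork.IsLimit.lift_ι lim
  have hw : lim.lift (KernelFork.ofι _ S.zero) ≫ r = 0 := by rw [e, hr]
  let d : S.LeftHomologyData :=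
    { K := K, H := H, i := i, π := r, wi := hi, hi := lim, wπ := hw
      hπ := CokernelCofork.IsColimit.ofπ' _ _ (fun {W} x hx =>
        have hx' : f' ≫ x = 0 := by rw [← e]; exact hx
        ⟨(hc W x hx').choose, (hc W x hx').choose_spec⟩) }
  let γ : ShortComplex.LeftHomologyMapData φ d h' :=
    { φK := φK, φH := φH, commi := h₁, commπ := h₂
      commf' := by
        rw [← cancel_mono h'.i, Category.assoc, Category.assoc, h'.f'_i, φ.comm₁₂]
        rw [h₁, ← d.f'_i, Category.assoc] }
  exact γ.quasiIso_iff.2 hiso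

section resolution

variable {A : Type} [SmallCategory A] [Abelian A] {t : ℕ} (M : Ct A t)
  (E : ZMod t → A) (j : ∀ i k, M.X i ⟶ E k)
  (hj₀ : ∀ i k, ¬ (pShape t).Rel i k → j i k = 0)

/-- The intermediate complex `M^i ⊕ E^i`. -/
def interCx : Ct A t where
  X i := M.X i ⊞ E i
  d i k := biprod.fst ≫ j i k ≫ biprod.inr
  shape i k h := by simp [hj₀ i k h]
  d_comp_d' := by intros; simp

variable (g : ∀ k, E k ⟶ M.cycles k)
  (hg : ∀ i k, j i k ≫ g k = M.toCycles i k)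

/-- The map from the intermediate complex to `M`. -/
def toM : interCx M E j hj₀ ⟶ M where
  f i := biprod.desc (𝟙 _) (g i ≫ M.iCycles i)
  comm' i k _ := by
    dsimp [interCx]
    ext
    · simp [reassoc_of% hg]
    · simp

variable (r : ∀ k, E k ⟶ M.homology k) (w : ∀ i k, j i k ≫ r k = 0)

/-- The map from the intermediate complex to the homology complex. -/
def toH : interCx M E j hj₀ ⟶ homologyCx M where
  f i := (biprod.desc 0 (r i) : M.X i ⊞ E i ⟶ M.homology i)
  comm' i k _ := by
    dsimp [interCx, homologyCx, mkZero]
    ext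
    · simp [w]
    · simp

variable (hE : ∀ i k, (pShape t).Rel i k → (ShortComplex.mk (j i k) (r k) (w i k)).ShortExact)

theorem pShape_rel_next (t : ℕ) (i : ZMod t) : (pShape t).Rel i ((pShape t).next i) := by
  have h : (pShape t).Rel i (i + 1) := rfl
  rw [(pShape t).next_eq' h]
  exact h

include hE in
theorem quasiIso_of_data {M' : Ct A t} (φ : interCx M E j hj₀ ⟶ M') (k : ZMod t)
    (h' : (M'.sc k).LeftHomologyData) (φK : E k ⟶ h'.K) (φH : M.homology k ⟶ h'.H) (hiso : IsIso φH)
    (h₁ : φK ≫ h'.i = (biprod.inr : E k ⟶ M.X k ⊞ E k) ≫ φ.f k)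
    (h₂ : r k ≫ φH = φK ≫ h'.π) : QuasiIsoAt φ k := by
  have m := (hE _ _ (pShape_rel_next t k)).mono_f
  have ex := hE _ _ (pShape_rel_prev t k)
  have e := ex.epi_g
  dsimp at m e
  have c₀ : Mono (biprod.inr : E k ⟶ M.X k ⊞ E k) := inferInstance
  have c₁ : (biprod.inr : E k ⟶ M.X k ⊞ E k) ≫ biprod.fst ≫ j k ((pShape t).next k) ≫
      (biprod.inr : _ ⟶ M.X ((pShape t).next k) ⊞ E ((pShape t).next k)) = 0 := by simp
  have c₂ (W : A) (x : W ⟶ M.X k ⊞ E k)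
      (hx : x ≫ biprod.fst ≫ j k ((pShape t).next k) ≫
      (biprod.inr : _ ⟶ M.X ((pShape t).next k) ⊞ E ((pShape t).next k)) = 0) :
      ∃ y : W ⟶ E k, y ≫ (biprod.inr : E k ⟶ M.X k ⊞ E k) = x := by
    refine ⟨x ≫ biprod.snd, ?_⟩
    have h0 : x ≫ biprod.fst = 0 := by
      rw [← cancel_mono (j k ((pShape t).next k)),
        ← cancel_mono (biprod.inr : E ((pShape t).next k) ⟶
          M.X ((pShape t).next k) ⊞ E ((pShape t).next k))]
      simpa using hx
    apply biprod.hom_ext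
    · simp [h0]
    · simp
  let f' : M.X ((pShape t).prev k) ⊞ E ((pShape t).prev k) ⟶ E k := biprod.fst ≫ j _ _
  have c₃ : f' ≫ (biprod.inr : E k ⟶ M.X k ⊞ E k) = biprod.fst ≫ j _ _ ≫ biprod.inr := by
    simp [f']
  have c₄ : f' ≫ r k = 0 := by simp [f', w]
  have c₅ (W : A) (x : E k ⟶ W) (hx : f' ≫ x = 0) : ∃ y : M.homology k ⟶ W, r k ≫ y = x := by
    have hx' : j ((pShape t).prev k) k ≫ x = 0 := by
      have := (biprod.inl : M.X ((pShape t).prev k) ⟶ _ ⊞ E ((pShape t).prev k)) ≫= hx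
      simpa [f'] using this
    exact ⟨ex.exact.desc x hx', ex.exact.g_desc x hx'⟩
  rw [quasiIsoAt_iff]
  exact sc_quasiIso (S := (interCx M E j hj₀).sc k) _ h'
    (biprod.inr : E k ⟶ M.X k ⊞ E k) f' (r k) c₀ c₃ c₁ c₂ c₄ c₅ φK φH hiso h₁ h₂

include hE hg in
theorem quasiIso_toM (hr : ∀ k, g k ≫ M.homologyπ k = r k) :
    QuasiIso (toM M E j hj₀ g hg) where
  quasiIsoAt k := by
    refine quasiIso_of_data M E j hj₀ r w hE _ k
      (ShortComplex.LeftHomologyData.canonical (M.sc k)) (g k) (𝟙 (M.homology k))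
      (inferInstanceAs (IsIso (𝟙 (M.homology k)))) ?_ ?_
    · change g k ≫ M.iCycles k = (biprod.inr : E k ⟶ M.X k ⊞ E k) ≫
        biprod.desc (𝟙 _) (g k ≫ M.iCycles k)
      simp
    · exact (Category.comp_id _).trans (hr k).symm

include hE in
theorem quasiIso_toH : QuasiIso (toH M E j hj₀ r w) where
  quasiIsoAt k := by
    refine quasiIso_of_data M E j hj₀ r w hE _ k
      (ShortComplex.LeftHomologyData.ofZeros ((homologyCx M).sc k) rfl rfl)
      (r k) (𝟙 (M.homology k))
      (inferInstanceAs (IsIso (𝟙 (M.homology k)))) ?_ ?_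
    · change r k ≫ 𝟙 (M.homology k) = (biprod.inr : E k ⟶ M.X k ⊞ E k) ≫
        biprod.desc 0 (r k)
      simp
    · rfl

end resolution

theorem complex_iso_homology_in_relative_derived_category
    (A : Type) [SmallCategory A] [Abelian A] [HasExt.{0} A]
    -- hereditary: Ext² vanishes identically
    (hered : ∀ X Y : A, Subsingleton (Abelian.Ext X Y 2))
    (t : ℕ)
    -- the relative derived category `D_t(A)`, i.e. any localization of `C_t(A)`
    -- at the quasi-isomorphisms
    (E : Type*) [Category E] (L : Ct A t ⥤ E)
    [L.IsLocalization (HomologicalComplex.quasiIso A (pShape t))]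
    (M : Ct A t)
    -- boundedness, in the case `t = 0` of `ℤ`-indexed complexes
    (hbd : t = 0 → Set.Finite {i : ZMod t | ¬ IsZero (M.X i)}) :
    Nonempty (L.obj M ≅ L.obj (homologyCx M)) := by
  choose E j r g w h₁ h₂ h₃ h₄ using exists_data hered M
  have q₁ := quasiIso_toM M E (fun i k => j k i) (fun i k => h₃ k i) g (fun i k => h₁ k i) r
    (fun i k => w k i) (fun i k => h₄ k i) h₂
  have q₂ := quasiIso_toH M E (fun i k => j k i) (fun i k => h₃ k i) r
    (fun i k => w k i) (fun i k => h₄ k i)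
  have i₁ := Localization.inverts L (HomologicalComplex.quasiIso A (pShape t)) _ q₁
  have i₂ := Localization.inverts L (HomologicalComplex.quasiIso A (pShape t)) _ q₂
  exact ⟨(asIso (L.map (toM M E (fun i k => j k i) (fun i k => h₃ k i) g
    (fun i k => h₁ k i)))).symm ≪≫ asIso (L.map (toH M E (fun i k => j k i)
    (fun i k => h₃ k i) r (fun i k => w k i)))⟩

end GreenDH
end
end
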